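/- arXiv:1504.01076 — 2 statements merged into one kernel-verified Lean document; each statement's English description precedes it below -/
import Mathlib

section
/- There exists a universal constant C > 0 with the following property. Let n ≥ d ≥ 1 be integers, ε, δ ∈ (0, 1), and let m be an integer with m ≥ C·(d/ε²)·log(d/(ε·δ)). Let L be a d-dimensional linear subspace of ℝⁿ, S ⊆ L, and let A be a random m × n matrix with i.i.d. standard Cauchy entries. Then with probability at least 1 − δ the following holds: every x̂ ∈ S satisfying ‖A·x̂‖_med ≤ ‖A·x‖_med for all x ∈ S also satisfies ‖x̂‖₁ ≤ ((1+ε)/(1−ε))·inf_{x ∈ S} ‖x‖₁. -/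
open scoped Classical
open MeasureTheory

/-- The standard Cauchy distribution on ℝ, with density `1/(π(1 + t²))`. -/
noncomputable def cauchyMeasure : Measure ℝ :=
  volume.withDensity fun t => ENNReal.ofReal (1 / (Real.pi * (1 + t ^ 2)))

/-- `‖v‖_med`: the `⌈m/2⌉`-th smallest value among `|v₁|, …, |v_m|`
(the median of the absolute values). -/
noncomputable def medNorm {m : ℕ} (v : Fin m → ℝ) : ℝ :=
  sInf {t : ℝ | (m + 1) / 2 ≤ (Finset.univ.filter fun i => |v i| ≤ t).card}

section Cauchy

open Complex in
theorem integrable_cexp_neg_two_pi_abs :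
    Integrable fun v : ℝ => cexp (-2 * Real.pi * |v| : ℝ) := by
  have h1 : IntegrableOn (fun v : ℝ => cexp (-2 * Real.pi * |v| : ℝ)) (Set.Iic 0) := by
    refine (integrableOn_exp_mul_complex_Iic (a := 2 * Real.pi) (by simp [Real.pi_pos]) 0).congr_fun
      (fun v hv => ?_) measurableSet_Iic
    simp [abs_of_nonpos (show v ≤ 0 from hv)]
  have h2 : IntegrableOn (fun v : ℝ => cexp (-2 * Real.pi * |v| : ℝ)) (Set.Ioi 0) := by
    refine (integrableOn_exp_mul_complex_Ioi (a := -2 * Real.pi)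
      (by simp [Real.pi_pos]) 0).congr_fun (fun v hv => ?_) measurableSet_Ioi
    simp [abs_of_pos (show 0 < v from hv)]
  rw [← integrableOn_univ, ← Set.Iic_union_Ioi (a := (0 : ℝ))]
  exact h1.union h2

open Complex in
theorem cexp_mul_cexp_neg_two_pi_abs_eqOn_Iic (w : ℝ) :
    Set.EqOn (fun v : ℝ => cexp ((2 * Real.pi - 2 * Real.pi * w * I) * v))
      (fun v : ℝ => cexp (↑(-2 * Real.pi * v * w) * I) • cexp (-2 * Real.pi * |v| : ℝ))
      (Set.Iic 0) := by
  intro v hv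
  simp only [smul_eq_mul, ← Complex.exp_add, abs_of_nonpos (show v ≤ 0 from hv)]
  congr 1
  push_cast
  ring

open Complex in
theorem cexp_mul_cexp_neg_two_pi_abs_eqOn_Ioi (w : ℝ) :
    Set.EqOn (fun v : ℝ => cexp ((-2 * Real.pi - 2 * Real.pi * w * I) * v))
      (fun v : ℝ => cexp (↑(-2 * Real.pi * v * w) * I) • cexp (-2 * Real.pi * |v| : ℝ))
      (Set.Ioi 0) := by
  intro v hv
  simp only [smul_eq_mul, ← Complex.exp_add, abs_of_pos (show 0 < v from hv)]
  congr 1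
  push_cast
  ring

open Complex FourierTransform in
/-- The Fourier transform of `exp (-2π|v|)` is the Cauchy density. -/
theorem fourier_cexp_neg_two_pi_abs :
    𝓕 (fun v : ℝ => cexp (-2 * Real.pi * |v| : ℝ)) =
      fun w : ℝ => ((1 / (Real.pi * (1 + w ^ 2)) : ℝ) : ℂ) := by
  ext w
  have hπ : (Real.pi : ℂ) ≠ 0 := by exact_mod_cast Real.pi_ne_zero
  have ha : 0 < (2 * Real.pi - 2 * Real.pi * w * I : ℂ).re := by simp [Real.pi_pos]
  have hb : (-2 * Real.pi - 2 * Real.pi * w * I : ℂ).re < 0 := by simp [Real.pi_pos]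
  rw [Real.fourier_real_eq_integral_exp_smul, ← intervalIntegral.integral_Iic_add_Ioi (b := 0)
    ((integrableOn_exp_mul_complex_Iic ha 0).congr_fun
      (cexp_mul_cexp_neg_two_pi_abs_eqOn_Iic w) measurableSet_Iic)
    ((integrableOn_exp_mul_complex_Ioi hb 0).congr_fun
      (cexp_mul_cexp_neg_two_pi_abs_eqOn_Ioi w) measurableSet_Ioi),
    ← setIntegral_congr_fun measurableSet_Iic (cexp_mul_cexp_neg_two_pi_abs_eqOn_Iic w),
    ← setIntegral_congr_fun measurableSet_Ioi (cexp_mul_cexp_neg_two_pi_abs_eqOn_Ioi w),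
    integral_exp_mul_complex_Iic ha, integral_exp_mul_complex_Ioi hb]
  have h1 : (2 * Real.pi - 2 * Real.pi * w * I : ℂ) ≠ 0 := fun h => by simp [h] at ha
  have h2 : (-2 * Real.pi - 2 * Real.pi * w * I : ℂ) ≠ 0 := fun h => by
    rw [h] at hb
    exact lt_irrefl _ hb
  have h3 : (1 + (w : ℂ) ^ 2) ≠ 0 := by
    have : (1 + w ^ 2 : ℝ) ≠ 0 := by positivity
    exact_mod_cast this
  push_cast
  simp only [mul_zero, Complex.exp_zero]
  rw [div_add_div _ _ h1 h2, div_eq_div_iff (mul_ne_zero h1 h2) (mul_ne_zero hπ h3)]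
  linear_combination (-4 * Real.pi ^ 2 * w ^ 2 : ℂ) * I_sq

theorem integrable_cauchy_density :
    Integrable fun t : ℝ => 1 / (Real.pi * (1 + t ^ 2)) := by
  have h : (fun t : ℝ => 1 / (Real.pi * (1 + t ^ 2))) = fun t => Real.pi⁻¹ * (1 + t ^ 2)⁻¹ := by
    ext t
    rw [one_div, mul_inv]
  rw [h]
  exact integrable_inv_one_add_sq.const_mul _

theorem cauchy_density_nonneg (t : ℝ) : 0 ≤ 1 / (Real.pi * (1 + t ^ 2)) := by
  have := Real.pi_pos
  positivity

theorem measureReal_cauchyMeasure {s : Set ℝ} (hs : MeasurableSet s) :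
    cauchyMeasure.real s = Real.pi⁻¹ * ∫ t in s, (1 + t ^ 2)⁻¹ := by
  rw [measureReal_def, cauchyMeasure, withDensity_apply _ hs,
    ← integral_eq_lintegral_of_nonneg_ae (ae_of_all _ cauchy_density_nonneg)
      integrable_cauchy_density.aestronglyMeasurable.restrict, ← integral_const_mul]
  simp_rw [one_div, mul_inv]

instance isProbabilityMeasure_cauchyMeasure : IsProbabilityMeasure cauchyMeasure := by
  have : IsFiniteMeasure cauchyMeasure :=
    isFiniteMeasure_withDensity_ofReal integrable_cauchy_density.2
  refine ⟨?_⟩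
  have h := measureReal_cauchyMeasure MeasurableSet.univ
  rw [setIntegral_univ, integral_univ_inv_one_add_sq, inv_mul_cancel₀ Real.pi_ne_zero,
    measureReal_def] at h
  rw [← ENNReal.ofReal_toReal (measure_ne_top cauchyMeasure Set.univ), h, ENNReal.ofReal_one]

open Complex FourierTransform in
theorem charFun_cauchyMeasure (t : ℝ) : charFun cauchyMeasure t = cexp (-|t| : ℝ) := by
  have hc : Continuous fun v : ℝ => cexp (-2 * Real.pi * |v| : ℝ) := by fun_prop
  have h := congrFun (hc.fourierInv_fourier_eq integrable_cexp_neg_two_pi_abs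
    (by rw [fourier_cexp_neg_two_pi_abs]; exact integrable_cauchy_density.ofReal))
    (t / (2 * Real.pi))
  rw [Real.fourierInv_eq', fourier_cexp_neg_two_pi_abs] at h
  have hπ := Real.pi_pos
  have h2 : -2 * Real.pi * |t / (2 * Real.pi)| = -|t| := by
    rw [abs_div, abs_of_pos (by positivity : 0 < 2 * Real.pi)]
    field_simp
  rw [h2] at h
  rw [charFun_apply_real, cauchyMeasure,
    integral_withDensity_eq_integral_toReal_smul (by fun_prop) (by simp), ← h]
  refine integral_congr_ae (ae_of_all _ fun x => ?_)
  simp only [ENNReal.toReal_ofReal (cauchy_density_nonneg x), smul_eq_mul, real_smul]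
  rw [mul_comm]
  congr 2
  have : 2 * Real.pi * inner ℝ x (t / (2 * Real.pi)) = t * x := by
    simp only [RCLike.inner_apply, conj_trivial]
    field_simp
  rw [this]
  push_cast
  ring

open Complex in
/-- The Cauchy distribution is 1-stable. -/
theorem map_sum_mul_pi_cauchyMeasure {ι : Type*} [Fintype ι] (y : ι → ℝ) :
    (Measure.pi fun _ : ι => cauchyMeasure).map (fun a => ∑ j, a j * y j) =
      cauchyMeasure.map (fun t => (∑ j, |y j|) * t) := by
  have hm : Measurable fun a : ι → ℝ => ∑ j, a j * y j := by fun_prop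
  have := Measure.isProbabilityMeasure_map (μ := Measure.pi fun _ : ι => cauchyMeasure)
    hm.aemeasurable
  have := Measure.isProbabilityMeasure_map (μ := cauchyMeasure)
    (f := fun t => (∑ j, |y j|) * t) (by fun_prop)
  refine Measure.ext_of_charFun (funext fun t => ?_)
  rw [charFun_map_mul, charFun_cauchyMeasure, charFun_apply_real,
    integral_map hm.aemeasurable (by fun_prop)]
  have h1 : ∀ a : ι → ℝ, cexp (t * ((∑ j, a j * y j : ℝ) : ℂ) * I) =
      ∏ j, cexp (((y j * t : ℝ) : ℂ) * (a j : ℂ) * I) := fun a => by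
    rw [← Complex.exp_sum]
    push_cast
    rw [Finset.mul_sum, Finset.sum_mul]
    congr 1
    exact Finset.sum_congr rfl fun j _ => by ring
  simp_rw [h1]
  rw [integral_fintype_prod_eq_prod (fun j (x : ℝ) => cexp (((y j * t : ℝ) : ℂ) * (x : ℂ) * I))]
  simp_rw [← charFun_apply_real, charFun_cauchyMeasure]
  rw [← Complex.exp_sum, ← ofReal_sum, Finset.sum_neg_distrib]
  congr 3
  simp_rw [abs_mul, ← Finset.sum_mul]
  rw [abs_of_nonneg (Finset.sum_nonneg fun j _ => abs_nonneg (y j))]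

theorem measureReal_pi_cauchyMeasure_abs_sum {ι : Type*} [Fintype ι] (y : ι → ℝ)
    {s : Set ℝ} (hs : MeasurableSet s) :
    (Measure.pi fun _ : ι => cauchyMeasure).real {a | |∑ j, a j * y j| ∈ s} =
      cauchyMeasure.real {t | (∑ j, |y j|) * |t| ∈ s} := by
  have hs' : MeasurableSet {t : ℝ | |t| ∈ s} := measurable_norm hs
  have h := congrArg (fun μ : Measure ℝ => μ.real {t | |t| ∈ s}) (map_sum_mul_pi_cauchyMeasure y)
  beta_reduce at h
  rw [map_measureReal_apply (by fun_prop) hs', map_measureReal_apply (by fun_prop) hs'] at h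
  have h2 : {t : ℝ | (∑ j, |y j|) * |t| ∈ s} =
      (fun t => (∑ j, |y j|) * t) ⁻¹' {t | |t| ∈ s} := by
    ext t
    simp [abs_mul, abs_of_nonneg (Finset.sum_nonneg fun j _ => abs_nonneg (y j))]
  rw [h2]
  exact h

theorem cauchyMeasure_real_abs_le {r : ℝ} (hr : 0 ≤ r) :
    cauchyMeasure.real {t | |t| ≤ r} = 2 * Real.pi⁻¹ * Real.arctan r := by
  have h : {t : ℝ | |t| ≤ r} = Set.Icc (-r) r := by
    ext t
    simp [abs_le]
  rw [h, measureReal_cauchyMeasure measurableSet_Icc, integral_Icc_eq_integral_Ioc,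
    ← intervalIntegral.integral_of_le (by linarith), integral_inv_one_add_sq, Real.arctan_neg]
  ring

theorem cauchyMeasure_real_lt_abs {r : ℝ} (hr : 0 ≤ r) :
    cauchyMeasure.real {t | r < |t|} = 1 - 2 * Real.pi⁻¹ * Real.arctan r := by
  have h : {t : ℝ | r < |t|} = {t | |t| ≤ r}ᶜ := by
    ext t
    simp
  rw [h, probReal_compl_eq_one_sub (measurableSet_le (by fun_prop) (by fun_prop)),
    cauchyMeasure_real_abs_le hr]

theorem div_five_le_arctan_sub_arctan {a b : ℝ} (ha : 0 ≤ a) (hab : a ≤ b) (hb : b ≤ 2) :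
    (b - a) / 5 ≤ Real.arctan b - Real.arctan a := by
  have h := (convex_Icc (0 : ℝ) 2).mul_sub_le_image_sub_of_le_deriv
    Real.continuous_arctan.continuousOn Real.differentiable_arctan.differentiableOn
    (C := 1 / 5) (fun x hx => ?_) a ⟨ha, hab.trans hb⟩ b ⟨ha.trans hab, hb⟩ hab
  · linarith
  · rw [interior_Icc] at hx
    rw [Real.deriv_arctan]
    exact one_div_le_one_div_of_le (by positivity) (by nlinarith [hx.1, hx.2])

theorem cauchyMeasure_real_lt_abs_le {r : ℝ} (hr : 0 < r) :
    cauchyMeasure.real {t | r < |t|} ≤ 1 / r := by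
  have hπ := Real.pi_gt_three
  have h1 := Real.arctan_inv_of_pos hr
  have h2 : Real.arctan r⁻¹ ≤ r⁻¹ := by
    conv_rhs => rw [← Real.tan_arctan r⁻¹]
    exact Real.le_tan (Real.arctan_nonneg.2 (by positivity)) (Real.arctan_lt_pi_div_two _)
  have h3 : 2 * Real.pi⁻¹ ≤ 1 := by
    rw [← div_eq_mul_inv, div_le_one (by linarith)]
    linarith
  have h4 : Real.arctan r = Real.pi / 2 - Real.arctan r⁻¹ := by linarith
  have h5 : 0 < r⁻¹ := by positivity
  have h6 : Real.pi⁻¹ * Real.pi = 1 := inv_mul_cancel₀ (by positivity)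
  rw [cauchyMeasure_real_lt_abs hr.le, h4, one_div]
  have h7 : 2 * Real.pi⁻¹ * Real.arctan r⁻¹ ≤ 2 * Real.pi⁻¹ * r⁻¹ := by gcongr
  have h8 : 2 * Real.pi⁻¹ * r⁻¹ ≤ 1 * r⁻¹ := by gcongr
  linarith

theorem div_ten_le_two_mul_inv_pi_mul {a b : ℝ} (ha : 0 ≤ a) (hab : a ≤ b) (hb : b ≤ 2) :
    (b - a) / 10 ≤ 2 * Real.pi⁻¹ * (Real.arctan b - Real.arctan a) := by
  have hπ := Real.pi_le_four
  have hπ' := Real.pi_pos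
  have h1 : (1 / 2 : ℝ) ≤ 2 * Real.pi⁻¹ := by
    rw [← div_eq_mul_inv, div_le_div_iff₀ (by norm_num) hπ']
    linarith
  have h2 := div_five_le_arctan_sub_arctan ha hab hb
  calc (b - a) / 10 = 1 / 2 * ((b - a) / 5) := by ring
    _ ≤ 2 * Real.pi⁻¹ * (Real.arctan b - Real.arctan a) :=
      mul_le_mul h1 h2 (by linarith) (by positivity)

theorem two_mul_inv_pi_mul_arctan_one : 2 * Real.pi⁻¹ * Real.arctan 1 = 1 / 2 := by
  rw [Real.arctan_one]
  field_simp
  norm_num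

theorem cauchyMeasure_real_abs_le_one_sub {η : ℝ} (h0 : 0 ≤ η) (h1 : η ≤ 1) :
    cauchyMeasure.real {t | |t| ≤ 1 - η} ≤ 1 / 2 - η / 10 := by
  rw [cauchyMeasure_real_abs_le (by linarith)]
  have h2 := div_ten_le_two_mul_inv_pi_mul (a := 1 - η) (b := 1) (by linarith) (by linarith)
      (by norm_num)
  rw [mul_sub, two_mul_inv_pi_mul_arctan_one] at h2
  linarith

theorem cauchyMeasure_real_one_add_lt_abs {η : ℝ} (h0 : 0 ≤ η) (h1 : η ≤ 1) :
    cauchyMeasure.real {t | 1 + η < |t|} ≤ 1 / 2 - η / 10 := by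
  rw [cauchyMeasure_real_lt_abs (by linarith)]
  have h2 := div_ten_le_two_mul_inv_pi_mul (a := 1) (b := 1 + η) (by linarith) (by linarith)
      (by linarith)
  rw [mul_sub, two_mul_inv_pi_mul_arctan_one] at h2
  linarith

end Cauchy

section Median

theorem medNorm_le {m : ℕ} (hm : 0 < m) {v : Fin m → ℝ} {t : ℝ}
    (h : (m + 1) / 2 ≤ (Finset.univ.filter fun i => |v i| ≤ t).card) : medNorm v ≤ t := by
  refine csInf_le ⟨0, fun s hs => ?_⟩ h
  have hs' : 0 < (Finset.univ.filter fun i => |v i| ≤ s).card :=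
    lt_of_lt_of_le (by omega) (Set.mem_ofPred_eq ▸ hs)
  obtain ⟨i, hi⟩ := Finset.card_pos.1 hs'
  exact (abs_nonneg _).trans (Finset.mem_filter.1 hi).2

theorem le_medNorm {m : ℕ} {v : Fin m → ℝ} {t : ℝ}
    (h : ∀ s < t, (Finset.univ.filter fun i => |v i| ≤ s).card < (m + 1) / 2) :
    t ≤ medNorm v := by
  refine le_csInf ⟨∑ i, |v i|, ?_⟩ fun s hs => ?_
  · have : (Finset.univ.filter fun i => |v i| ≤ ∑ i, |v i|) = Finset.univ :=
      Finset.filter_true_of_mem fun i hi =>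
        Finset.single_le_sum (f := fun i => |v i|) (fun j _ => abs_nonneg _) hi
    rw [Set.mem_ofPred_eq, this, Finset.card_univ, Fintype.card_fin]
    omega
  · by_contra! hst
    exact absurd (h s hst) (not_lt.2 hs)

theorem medNorm_le_of_card_lt {m : ℕ} (hm : 0 < m) {v : Fin m → ℝ} {t : ℝ}
    (h : ((Finset.univ.filter fun i => t < |v i|).card : ℝ) < m / 2) : medNorm v ≤ t := by
  refine medNorm_le hm ?_
  have h1 := Finset.card_filter_add_card_filter_not (s := Finset.univ) (fun i => |v i| ≤ t)
  simp only [not_le, Finset.card_univ, Fintype.card_fin] at h1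
  rw [lt_div_iff₀ two_pos] at h
  have h2 : (Finset.univ.filter fun i => t < |v i|).card * 2 < m := by exact_mod_cast h
  omega

theorem le_medNorm_of_card_lt {m : ℕ} {v : Fin m → ℝ} {t : ℝ}
    (h : ((Finset.univ.filter fun i => |v i| ≤ t).card : ℝ) < m / 2) : t ≤ medNorm v := by
  refine le_medNorm fun s hs => ?_
  have h1 : (Finset.univ.filter fun i => |v i| ≤ s).card ≤
      (Finset.univ.filter fun i => |v i| ≤ t).card :=
    Finset.card_le_card (Finset.monotone_filter_right _ fun i _ hi => hi.trans hs.le)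
  rw [lt_div_iff₀ two_pos] at h
  have h2 : (Finset.univ.filter fun i => |v i| ≤ t).card * 2 < m := by exact_mod_cast h
  omega

theorem medNorm_zero_le {m : ℕ} (hm : 0 < m) : medNorm (0 : Fin m → ℝ) ≤ 0 :=
  medNorm_le_of_card_lt hm (by simp [hm])

theorem medNorm_smul {m : ℕ} {c : ℝ} (hc : c ≠ 0) (v : Fin m → ℝ) :
    medNorm (c • v) = |c| * medNorm v := by
  have hc' : 0 < |c| := abs_pos.2 hc
  unfold medNorm
  rw [← smul_eq_mul, ← Real.sInf_smul_of_nonneg hc'.le]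
  congr 1
  ext t
  rw [Set.mem_smul_set_iff_inv_smul_mem₀ hc'.ne']
  simp only [Set.mem_ofPred_eq, Pi.smul_apply, smul_eq_mul, abs_mul, le_inv_mul_iff₀ hc']

theorem medNorm_pos {m : ℕ} (hm : 0 < m) {v : Fin m → ℝ} (hv : ∀ i, v i ≠ 0) : 0 < medNorm v := by
  have : Nonempty (Fin m) := ⟨⟨0, hm⟩⟩
  obtain ⟨i, hi⟩ := Finite.exists_min fun i => |v i|
  refine (abs_pos.2 (hv i)).trans_le (le_medNorm fun s hs => ?_)
  rw [Finset.filter_false_of_mem fun j _ => not_le.2 (hs.trans_le (hi j)), Finset.card_empty]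
  omega

end Median

section Concentration

/-- **Hoeffding's inequality** for the number of i.i.d. samples that fall in a given set. -/
theorem measureReal_pi_card_filter_ge_le {α : Type*} [MeasurableSpace α] (μ : Measure α)
    [IsProbabilityMeasure μ] (m : ℕ) {E : Set α} (hE : MeasurableSet E) {p τ : ℝ}
    (hp : μ.real E ≤ p) (hτ : 0 ≤ τ) :
    (Measure.pi fun _ : Fin m => μ).real
      {ω | (p + τ) * m ≤ ((Finset.univ.filter fun i => ω i ∈ E).card : ℝ)} ≤
      Real.exp (-2 * τ ^ 2 * m) := by
  set P := Measure.pi fun _ : Fin m => μ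
  set f : α → ℝ := E.indicator 1 with hf
  have hfm : Measurable f := measurable_one.indicator hE
  have hint : ∀ i : Fin m, ∫ ω, f (ω i) ∂P = μ.real E := fun i => by
    rw [← integral_map (φ := fun ω : Fin m → α => ω i) (f := f)
      (measurable_pi_apply i).aemeasurable hfm.aestronglyMeasurable,
      (measurePreserving_eval (fun _ : Fin m => μ) i).map_eq]
    exact integral_indicator_one hE
  have hind : ProbabilityTheory.iIndepFun (fun (i : Fin m) ω => f (ω i) - μ.real E) P :=
    ProbabilityTheory.iIndepFun_pi (X := fun _ a => f a - μ.real E)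
      fun _ => (hfm.sub_const _).aemeasurable
  have hsub : ∀ i ∈ (Finset.univ : Finset (Fin m)),
      ProbabilityTheory.HasSubgaussianMGF (fun ω => f (ω i) - μ.real E)
        ((‖(1 : ℝ) - 0‖₊ / 2) ^ 2) P :=
    fun i _ => by
    have h := ProbabilityTheory.hasSubgaussianMGF_of_mem_Icc (μ := P) (X := fun ω => f (ω i))
      (a := 0) (b := 1) (hfm.comp (measurable_pi_apply i)).aemeasurable
      (ae_of_all _ fun ω => by by_cases h : ω i ∈ E <;> simp [hf, h])
    rwa [hint] at h
  have h := ProbabilityTheory.HasSubgaussianMGF.measure_sum_ge_le_of_iIndepFun hind hsub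
    (ε := τ * m) (by positivity)
  refine (measureReal_mono fun ω hω => ?_).trans (h.trans (le_of_eq ?_))
  · have hcard : ∑ i, f (ω i) = ((Finset.univ.filter fun i => ω i ∈ E).card : ℝ) := by
      simp [hf, Set.indicator_apply]
    simp only [Set.mem_ofPred_eq] at hω ⊢
    rw [Finset.sum_sub_distrib, hcard, Finset.sum_const, Finset.card_univ, Fintype.card_fin,
      nsmul_eq_mul]
    have := mul_le_mul_of_nonneg_left hp (Nat.cast_nonneg (α := ℝ) m)
    linarith
  · congr 1
    rcases Nat.eq_zero_or_pos m with rfl | hm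
    · simp
    · have : (m : ℝ) ≠ 0 := by positivity
      simp
      field_simp

theorem map_curry_pi {ι κ X : Type*} [Fintype ι] [Fintype κ] [MeasurableSpace X] (μ : Measure X)
    [IsProbabilityMeasure μ] :
    (Measure.pi fun _ : ι × κ => μ).map (MeasurableEquiv.curry ι κ X) =
      Measure.pi fun _ : ι => Measure.pi fun _ : κ => μ := by
  simpa [Measure.infinitePi_eq_pi] using Measure.infinitePi_map_curry fun (_ : ι) (_ : κ) => μ

/-- The number of rows of an i.i.d. random matrix that fall in a given set is concentrated. -/
theorem measureReal_card_rows_ge_le {κ X : Type*} [Fintype κ] [MeasurableSpace X] (μ : Measure X)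
    [IsProbabilityMeasure μ] (m : ℕ) {E : Set (κ → X)} (hE : MeasurableSet E) {p τ : ℝ}
    (hp : (Measure.pi fun _ : κ => μ).real E ≤ p) (hτ : 0 ≤ τ) :
    (Measure.pi fun _ : Fin m × κ => μ).real
      {ω | (p + τ) * m ≤ ((Finset.univ.filter fun i => (fun j => ω (i, j)) ∈ E).card : ℝ)} ≤
      Real.exp (-2 * τ ^ 2 * m) := by
  have h := measureReal_pi_card_filter_ge_le _ m hE hp hτ
  rw [← map_curry_pi, measureReal_def, MeasurableEquiv.map_apply] at h
  exact h

end Concentration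

section Auerbach

open Module in
/-- **Auerbach's lemma**: the unit ball of a finite-dimensional normed space contains a basis whose
coordinate functionals have norm at most one. -/
theorem exists_basis_le_one_abs_coord_le {E ι : Type*} [NormedAddCommGroup E] [NormedSpace ℝ E]
    [FiniteDimensional ℝ E] [Fintype ι] (e : Basis ι ℝ E) (p : Seminorm ℝ E) (hp : Continuous p)
    (hle : ∀ x, ‖x‖ ≤ p x) :
    ∃ b : Basis ι ℝ E, (∀ j, p (b j) ≤ 1) ∧ ∀ x j, |b.repr x j| ≤ p x := by
  have hppos : ∀ x, x ≠ 0 → 0 < p x := fun x hx => (norm_pos_iff.2 hx).trans_le (hle x)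
  have : ProperSpace E := FiniteDimensional.proper_real E
  set B : Set E := {x | p x ≤ 1} with hB
  have hBc : IsCompact B :=
    (isCompact_closedBall (0 : E) 1).of_isClosed_subset (isClosed_le hp continuous_const)
      fun x hx => mem_closedBall_zero_iff.2 ((hle x).trans hx)
  have hKc : IsCompact (Set.univ.pi fun _ : ι => B) := isCompact_univ_pi fun _ => hBc
  have hdet : Continuous fun v : ι → E => |e.det v| := by
    simp_rw [Basis.det_apply]
    refine (Continuous.matrix_det (continuous_matrix fun i j => ?_)).abs
    exact ((e.coord i).continuous_of_finiteDimensional).comp (continuous_apply j)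
  obtain ⟨v, hvK, hv⟩ := hKc.exists_isMaxOn
    ⟨0, fun j _ => by simp [hB]⟩ hdet.continuousOn
  have hvK' : ∀ j, p (v j) ≤ 1 := fun j => hvK j trivial
  have hpe : ∀ j, 0 < p (e j) := fun j => hppos _ (e.ne_zero j)
  have hv0 : e.det v ≠ 0 := by
    have h1 : |e.det fun j => (p (e j))⁻¹ • e j| ≤ |e.det v| :=
      hv (a := fun j => (p (e j))⁻¹ • e j) fun j _ => by
        simp [hB, map_smul_eq_mul, abs_of_pos (hpe j), (hpe j).ne']
    have h2 : 0 < |e.det fun j => (p (e j))⁻¹ • e j| := by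
      rw [AlternatingMap.map_smul_univ, Basis.det_self]
      simpa [abs_pos, Finset.prod_ne_zero_iff] using fun j => (hpe j).ne'
    exact abs_pos.1 (h2.trans_le h1)
  obtain ⟨hli, hsp⟩ := e.is_basis_iff_det.2 (isUnit_iff_ne_zero.2 hv0)
  have hcoord : ∀ x j, p x ≤ 1 → |(Basis.mk hli hsp.ge).repr x j| ≤ 1 := by
    intro x j hx
    have h1 : |e.det (Function.update v j x)| ≤ |e.det v| :=
      hv (a := Function.update v j x) fun k _ => by
        rcases eq_or_ne k j with rfl | hk
        · simpa [hB] using hx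
        · simpa [hB, hk] using hvK' k
    have h2 := LinearMap.congr_fun (e.det_smul_mk_coord_eq_det_update hli hsp.ge j) x
    simp only [LinearMap.smul_apply, smul_eq_mul, Basis.coord_apply,
      MultilinearMap.toLinearMap_apply] at h2
    have h3 : |e.det v| * |(Basis.mk hli hsp.ge).repr x j| ≤ |e.det v| * 1 := by
      rw [← abs_mul, h2, mul_one]
      exact h1
    exact le_of_mul_le_mul_left h3 (abs_pos.2 hv0)
  refine ⟨Basis.mk hli hsp.ge, fun j => by simpa using hvK' j, fun x j => ?_⟩
  rcases eq_or_ne x 0 with rfl | hx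
  · rw [map_zero, Finsupp.zero_apply, abs_zero, map_zero]
  · have h := hcoord ((p x)⁻¹ • x) j (by
      simp [map_smul_eq_mul, abs_of_pos (hppos x hx), (hppos x hx).ne'])
    rwa [map_smul, Finsupp.smul_apply, smul_eq_mul, abs_mul, abs_inv, abs_of_pos (hppos x hx),
      inv_mul_le_iff₀ (hppos x hx), mul_one] at h

theorem Submodule.exists_basis_sum_abs_le_one {n d : ℕ} (L : Submodule ℝ (Fin n → ℝ))
    (hL : Module.finrank ℝ L = d) :
    ∃ b : Fin d → Fin n → ℝ, (∀ k, ∑ j, |b k j| ≤ 1) ∧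
      ∀ x ∈ L, ∃ c : Fin d → ℝ, (∀ k, |c k| ≤ ∑ j, |x j|) ∧ x = ∑ k, c k • b k := by
  let p : Seminorm ℝ L := Seminorm.of (fun x => ∑ j, |(x : Fin n → ℝ) j|)
    (fun x y => by
      rw [← Finset.sum_add_distrib]
      exact Finset.sum_le_sum fun j _ => abs_add_le _ _)
    (fun a x => by simp [abs_mul, Finset.mul_sum])
  have hp : Continuous p := by
    change Continuous fun x : L => ∑ j, |(x : Fin n → ℝ) j|
    exact continuous_finsetSum _ fun j _ =>
      ((continuous_apply j).comp continuous_subtype_val).abs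
  obtain ⟨b, hb1, hb2⟩ := exists_basis_le_one_abs_coord_le
    (Module.finBasisOfFinrankEq ℝ L hL) p hp fun x => by
      rw [Submodule.coe_norm, pi_norm_le_iff_of_nonneg (apply_nonneg p x)]
      exact fun j => Finset.single_le_sum (f := fun j => |(x : Fin n → ℝ) j|)
        (fun j _ => abs_nonneg _) (Finset.mem_univ j)
  refine ⟨fun k => b k, hb1, fun x hx => ⟨fun k => b.repr ⟨x, hx⟩ k, hb2 ⟨x, hx⟩, ?_⟩⟩
  have h := congrArg (Subtype.val) (b.sum_repr ⟨x, hx⟩)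
  simpa only [Submodule.coe_sum, Submodule.coe_smul] using h.symm

end Auerbach

section Net

theorem sum_mul_sum_smul {ι κ : Type*} [Fintype ι] [Fintype κ] (a : ι → ℝ) (c : κ → ℝ)
    (b : κ → ι → ℝ) :
    ∑ j, a j * (∑ k, c k • b k) j = ∑ k, c k * ∑ j, a j * b k j := by
  simp only [Finset.sum_apply, Pi.smul_apply, smul_eq_mul, Finset.mul_sum]
  rw [Finset.sum_comm]
  exact Finset.sum_congr rfl fun k _ => Finset.sum_congr rfl fun j _ => by ring

theorem sum_abs_sum_smul_le {ι κ : Type*} [Fintype ι] [Fintype κ] (c : κ → ℝ)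
    {b : κ → ι → ℝ} (hb : ∀ k, ∑ j, |b k j| ≤ 1) :
    ∑ j, |(∑ k, c k • b k) j| ≤ ∑ k, |c k| := by
  calc ∑ j, |(∑ k, c k • b k) j| ≤ ∑ j, ∑ k, |c k| * |b k j| := by
        refine Finset.sum_le_sum fun j _ => ?_
        simp only [Finset.sum_apply, Pi.smul_apply, smul_eq_mul, ← abs_mul]
        exact Finset.abs_sum_le_sum_abs _ _
    _ = ∑ k, |c k| * ∑ j, |b k j| := by
        rw [Finset.sum_comm]
        simp_rw [Finset.mul_sum]
    _ ≤ ∑ k, |c k| := Finset.sum_le_sum fun k _ => mul_le_of_le_one_right (abs_nonneg _) (hb k)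

/-- The grid of integer coefficient vectors with entries between `-K` and `K`. -/
noncomputable def coeffGrid (d K : ℕ) : Finset (Fin d → ℤ) :=
  Fintype.piFinset fun _ => Finset.Icc (-(K : ℤ)) K

theorem card_coeffGrid (d K : ℕ) : (coeffGrid d K).card = (2 * K + 1) ^ d := by
  simp only [coeffGrid, Fintype.card_piFinset, Int.card_Icc, Finset.prod_const, Finset.card_univ,
    Fintype.card_fin]
  congr 1
  omega

/-- The vector with coefficients `f / K` in the family `b`. -/
noncomputable def gridVec {n d : ℕ} (b : Fin d → Fin n → ℝ) (K : ℕ) (f : Fin d → ℤ) : Fin n → ℝ :=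
  ∑ k, ((f k : ℝ) / K) • b k

theorem exists_mem_coeffGrid {d K : ℕ} (hK : 0 < K) {c : Fin d → ℝ} (hc : ∀ k, |c k| ≤ 1) :
    ∃ f ∈ coeffGrid d K, ∀ k, |c k - (f k : ℝ) / K| ≤ 1 / K := by
  have hK' : (0 : ℝ) < K := by exact_mod_cast hK
  refine ⟨fun k => ⌊(K : ℝ) * c k⌋, ?_, fun k => ?_⟩
  · refine Fintype.mem_piFinset.2 fun k => Finset.mem_Icc.2 ⟨?_, ?_⟩
    · rw [Int.le_floor]
      push_cast
      nlinarith [(abs_le.1 (hc k)).1]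
    · have : (⌊(K : ℝ) * c k⌋ : ℝ) ≤ ((K : ℤ) : ℝ) := by
        push_cast
        exact (Int.floor_le _).trans (by nlinarith [(abs_le.1 (hc k)).2])
      exact_mod_cast this
  · have h1 := Int.floor_le ((K : ℝ) * c k)
    have h2 := (Int.lt_floor_add_one ((K : ℝ) * c k)).le
    have h3 : c k - (⌊(K : ℝ) * c k⌋ : ℝ) / K = (K * c k - ⌊(K : ℝ) * c k⌋) / K := by
      field_simp
    rw [h3, abs_of_nonneg (div_nonneg (by linarith) hK'.le)]
    gcongr
    linarith

variable {m n d K : ℕ} {η : ℝ} {A : Fin m → Fin n → ℝ} {b : Fin d → Fin n → ℝ}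

theorem medNorm_mem_Icc_of_sum_abs_eq_one (hm : 0 < m) (hK : 0 < K) (hdK : d ≤ η * K)
    (hb : ∀ k, ∑ j, |b k j| ≤ 1)
    (hW : ((Finset.univ.filter fun i => η * K < ∑ k, |∑ j, A i j * b k j|).card : ℝ) < η / 20 * m)
    (hlow : ∀ f ∈ coeffGrid d K, ∑ j, |gridVec b K f j| ∈ Set.Icc (1 - η) (1 + η) →
      ((Finset.univ.filter fun i => |∑ j, A i j * gridVec b K f j| ≤ 1 - 2 * η).card : ℝ) <
        (1 / 2 - η / 20) * m)
    (hupp : ∀ f ∈ coeffGrid d K, ∑ j, |gridVec b K f j| ∈ Set.Icc (1 - η) (1 + η) →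
      ((Finset.univ.filter fun i => 1 + 3 * η < |∑ j, A i j * gridVec b K f j|).card : ℝ) <
        (1 / 2 - η / 20) * m)
    {c : Fin d → ℝ} (hc : ∀ k, |c k| ≤ 1) (hx : ∑ j, |(∑ k, c k • b k) j| = 1) :
    medNorm (fun i => ∑ j, A i j * (∑ k, c k • b k) j) ∈ Set.Icc (1 - 4 * η) (1 + 4 * η) := by
  have hK' : (0 : ℝ) < K := by exact_mod_cast hK
  obtain ⟨f, hf, hcf⟩ := exists_mem_coeffGrid hK hc
  have hη : 0 ≤ η := by
    by_contra! h
    have : η * K < 0 := mul_neg_of_neg_of_pos h hK'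
    linarith [(Nat.cast_nonneg d : (0 : ℝ) ≤ d)]
  set x := ∑ k, c k • b k with hxdef
  have hsub : x - gridVec b K f = ∑ k, (c k - (f k : ℝ) / K) • b k := by
    simp only [hxdef, gridVec, sub_smul, Finset.sum_sub_distrib]
  have hdist : ∑ j, |x j - gridVec b K f j| ≤ η := by
    have h := sum_abs_sum_smul_le (fun k => c k - (f k : ℝ) / K) hb
    rw [← hsub] at h
    refine h.trans ((Finset.sum_le_sum fun k _ => hcf k).trans ?_)
    rw [Finset.sum_const, Finset.card_univ, Fintype.card_fin, nsmul_eq_mul, mul_one_div,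
      div_le_iff₀ hK']
    exact hdK
  have hN : ∑ j, |gridVec b K f j| ∈ Set.Icc (1 - η) (1 + η) := by
    have h1 : ∑ j, |x j| ≤ ∑ j, |gridVec b K f j| + ∑ j, |x j - gridVec b K f j| := by
      rw [← Finset.sum_add_distrib]
      exact Finset.sum_le_sum fun j _ => by
        linarith [abs_sub_abs_le_abs_sub (x j) (gridVec b K f j)]
    have h2 : ∑ j, |gridVec b K f j| ≤ ∑ j, |x j| + ∑ j, |x j - gridVec b K f j| := by
      rw [← Finset.sum_add_distrib]
      exact Finset.sum_le_sum fun j _ => by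
        linarith [abs_sub_abs_le_abs_sub (gridVec b K f j) (x j),
          abs_sub_comm (x j) (gridVec b K f j)]
    constructor <;> linarith
  have hrow : ∀ i, ¬ η * K < ∑ k, |∑ j, A i j * b k j| →
      |∑ j, A i j * x j - ∑ j, A i j * gridVec b K f j| ≤ η := by
    intro i hi
    have h1 : ∑ j, A i j * x j - ∑ j, A i j * gridVec b K f j =
        ∑ k, (c k - (f k : ℝ) / K) * ∑ j, A i j * b k j := by
      rw [← sum_mul_sum_smul, ← hsub, ← Finset.sum_sub_distrib]
      exact Finset.sum_congr rfl fun j _ => by rw [Pi.sub_apply, mul_sub]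
    calc |∑ j, A i j * x j - ∑ j, A i j * gridVec b K f j|
        ≤ ∑ k, |(c k - (f k : ℝ) / K) * ∑ j, A i j * b k j| := by
          rw [h1]
          exact Finset.abs_sum_le_sum_abs _ _
      _ ≤ ∑ k, 1 / K * |∑ j, A i j * b k j| := by
          refine Finset.sum_le_sum fun k _ => ?_
          rw [abs_mul]
          exact mul_le_mul_of_nonneg_right (hcf k) (abs_nonneg _)
      _ ≤ η := by
          rw [← Finset.mul_sum, one_div, inv_mul_le_iff₀ hK', mul_comm]
          exact not_lt.1 hi
  have hcard : ∀ P Q : Fin m → Prop,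
      (∀ i, P i → (η * K < ∑ k, |∑ j, A i j * b k j|) ∨ Q i) →
      ((Finset.univ.filter Q).card : ℝ) < (1 / 2 - η / 20) * m →
      ((Finset.univ.filter P).card : ℝ) < m / 2 := by
    intro P Q hPQ hQ
    have h1 : (Finset.univ.filter P).card ≤
        (Finset.univ.filter fun i => η * K < ∑ k, |∑ j, A i j * b k j|).card +
          (Finset.univ.filter Q).card := by
      refine (Finset.card_le_card fun i hi => ?_).trans (Finset.card_union_le _ _)
      simpa using hPQ i (Finset.mem_filter.1 hi).2
    have h2 : ((Finset.univ.filter P).card : ℝ) ≤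
        (Finset.univ.filter fun i => η * K < ∑ k, |∑ j, A i j * b k j|).card +
          (Finset.univ.filter Q).card := by exact_mod_cast h1
    linarith
  constructor
  · refine le_medNorm_of_card_lt (hcard _ _ (fun i hi => ?_) (hlow f hf hN))
    refine or_iff_not_imp_left.2 fun h => ?_
    have h1 := abs_sub_abs_le_abs_sub (∑ j, A i j * gridVec b K f j) (∑ j, A i j * x j)
    rw [abs_sub_comm] at h1
    linarith [hrow i h]
  · refine medNorm_le_of_card_lt hm (hcard _ _ (fun i hi => ?_) (hupp f hf hN))
    refine or_iff_not_imp_left.2 fun h => ?_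
    have h1 := abs_sub_abs_le_abs_sub (∑ j, A i j * x j) (∑ j, A i j * gridVec b K f j)
    linarith [hrow i h]

theorem medNorm_mem_Icc_of_unit {r s : ℝ} (hm : 0 < m)
    (h0 : ∀ c : Fin d → ℝ, (∀ k, |c k| ≤ 1) → ∑ j, |(∑ k, c k • b k) j| = 1 →
      medNorm (fun i => ∑ j, A i j * (∑ k, c k • b k) j) ∈ Set.Icc r s)
    {c : Fin d → ℝ} {x : Fin n → ℝ} (hc : ∀ k, |c k| ≤ ∑ j, |x j|) (hx : x = ∑ k, c k • b k) :
    medNorm (fun i => ∑ j, A i j * x j) ∈ Set.Icc (r * ∑ j, |x j|) (s * ∑ j, |x j|) := by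
  set N := ∑ j, |x j| with hN
  rcases (Finset.sum_nonneg fun j _ => abs_nonneg (x j) : 0 ≤ ∑ j, |x j|).eq_or_lt with h | h
  · have hx0 : ∀ j, x j = 0 := fun j => by
      have := (Finset.sum_eq_zero_iff_of_nonneg fun j _ => abs_nonneg (x j)).1 h.symm j
      simpa using this
    have hz : (fun i => ∑ j, A i j * x j) = 0 := by
      ext i
      simp [hx0]
    rw [hz, hN, ← h, mul_zero, mul_zero]
    refine ⟨le_medNorm fun t ht => ?_, medNorm_zero_le hm⟩
    rw [Finset.filter_false_of_mem fun j _ => not_le.2 (ht.trans_le (abs_nonneg _)),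
      Finset.card_empty]
    omega
  · rw [← hN] at h
    have hx' : N⁻¹ • x = ∑ k, (N⁻¹ * c k) • b k := by
      rw [hx, Finset.smul_sum]
      simp_rw [smul_smul]
    have h1 := h0 (fun k => N⁻¹ * c k)
      (fun k => by
        rw [abs_mul, abs_inv, abs_of_pos h, inv_mul_le_iff₀ h, mul_one]
        exact hc k)
      (by
        rw [← hx']
        simp only [Pi.smul_apply, smul_eq_mul, abs_mul, ← Finset.mul_sum, abs_inv, abs_of_pos h]
        exact inv_mul_cancel₀ h.ne')
    rw [← hx'] at h1
    have h2 : (fun i => ∑ j, A i j * (N⁻¹ • x) j) = N⁻¹ • fun i => ∑ j, A i j * x j := by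
      ext i
      simp only [Pi.smul_apply, smul_eq_mul, Finset.mul_sum]
      exact Finset.sum_congr rfl fun j _ => by ring
    rw [h2, medNorm_smul (inv_ne_zero h.ne'), abs_inv, abs_of_pos h, Set.mem_Icc,
      le_inv_mul_iff₀ h, inv_mul_le_iff₀ h] at h1
    rwa [Set.mem_Icc, mul_comm r, mul_comm s]

end Net

section Embedding

variable {n : ℕ} {η : ℝ} {y : Fin n → ℝ}

theorem measureReal_abs_sum_mul_le (h0 : 0 ≤ η) (h1 : η ≤ 1 / 4) (hy : 1 - η ≤ ∑ j, |y j|) :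
    (Measure.pi fun _ : Fin n => cauchyMeasure).real {a | |∑ j, a j * y j| ≤ 1 - 2 * η} ≤
      1 / 2 - η / 10 := by
  refine (measureReal_pi_cauchyMeasure_abs_sum y (measurableSet_Iic (a := 1 - 2 * η))).trans_le
    ((measureReal_mono fun t ht => ?_).trans (cauchyMeasure_real_abs_le_one_sub h0 (by linarith)))
  simp only [Set.mem_Iic, Set.mem_ofPred_eq] at ht ⊢
  by_contra! h
  nlinarith [abs_nonneg t]

theorem measureReal_lt_abs_sum_mul_le (h0 : 0 ≤ η) (h1 : η ≤ 1 / 4) (hy : ∑ j, |y j| ≤ 1 + η) :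
    (Measure.pi fun _ : Fin n => cauchyMeasure).real {a | 1 + 3 * η < |∑ j, a j * y j|} ≤
      1 / 2 - η / 10 := by
  refine (measureReal_pi_cauchyMeasure_abs_sum y (measurableSet_Ioi (a := 1 + 3 * η))).trans_le
    ((measureReal_mono fun t ht => ?_).trans (cauchyMeasure_real_one_add_lt_abs h0 (by linarith)))
  simp only [Set.mem_Ioi, Set.mem_ofPred_eq] at ht ⊢
  by_contra! h
  nlinarith [abs_nonneg t]

theorem measureReal_lt_sum_abs_sum_mul_le {d : ℕ} (hd : 0 < d) {b : Fin d → Fin n → ℝ}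
    (hb : ∀ k, ∑ j, |b k j| ≤ 1) {T : ℝ} (hT : 0 < T) :
    (Measure.pi fun _ : Fin n => cauchyMeasure).real {a | T < ∑ k, |∑ j, a j * b k j|} ≤
      (d : ℝ) ^ 2 / T := by
  have hd' : (0 : ℝ) < d := by exact_mod_cast hd
  have hsub : {a : Fin n → ℝ | T < ∑ k, |∑ j, a j * b k j|} ⊆
      ⋃ k : Fin d, {a | T / d < |∑ j, a j * b k j|} := by
    intro a ha
    by_contra! h
    simp only [Set.mem_iUnion, Set.mem_ofPred_eq, not_exists, not_lt] at h ha
    have := Finset.sum_le_sum fun k (_ : k ∈ Finset.univ) => h k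
    rw [Finset.sum_const, Finset.card_univ, Fintype.card_fin, nsmul_eq_mul,
      mul_div_cancel₀ _ hd'.ne'] at this
    linarith
  have hk : ∀ k, (Measure.pi fun _ : Fin n => cauchyMeasure).real
      {a | T / d < |∑ j, a j * b k j|} ≤ d / T := by
    intro k
    refine (measureReal_pi_cauchyMeasure_abs_sum (b k) (measurableSet_Ioi (a := T / d))).trans_le
      ((measureReal_mono fun t ht => ?_).trans
        ((cauchyMeasure_real_lt_abs_le (r := T / d) (by positivity)).trans_eq (one_div_div _ _)))
    exact lt_of_lt_of_le ht (mul_le_of_le_one_left (abs_nonneg _) (hb k))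
  calc _ ≤ (Measure.pi fun _ : Fin n => cauchyMeasure).real
        (⋃ k : Fin d, {a | T / d < |∑ j, a j * b k j|}) := measureReal_mono hsub
    _ ≤ ∑ k : Fin d, (Measure.pi fun _ : Fin n => cauchyMeasure).real
        {a | T / d < |∑ j, a j * b k j|} := measureReal_iUnion_fintype_le _
    _ ≤ ∑ _k : Fin d, (d : ℝ) / T := Finset.sum_le_sum fun k _ => hk k
    _ = (d : ℝ) ^ 2 / T := by
        rw [Finset.sum_const, Finset.card_univ, Fintype.card_fin, nsmul_eq_mul]
        ring

/-- The median of a Cauchy sketch embeds a subspace with its `ℓ₁` norm, with high probability. -/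
theorem one_sub_le_measureReal_medNorm_mem_Icc {m d K : ℕ} (hm : 0 < m) (hd : 0 < d) (h0 : 0 < η)
    (h1 : η ≤ 1 / 4) (hK : 40 * (d : ℝ) ^ 2 ≤ η ^ 2 * K) (L : Submodule ℝ (Fin n → ℝ))
    (hL : Module.finrank ℝ L = d) :
    1 - (1 + 2 * (2 * K + 1) ^ d) * Real.exp (-(η ^ 2 * m / 800)) ≤
      (Measure.pi fun _ : Fin m × Fin n => cauchyMeasure).real
        {ω | ∀ x ∈ L, medNorm (fun i : Fin m => ∑ j, ω (i, j) * x j) ∈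
          Set.Icc ((1 - 4 * η) * ∑ j, |x j|) ((1 + 4 * η) * ∑ j, |x j|)} := by
  obtain ⟨b, hb, hbL⟩ := L.exists_basis_sum_abs_le_one hL
  set P := Measure.pi fun _ : Fin m × Fin n => cauchyMeasure with hP
  have hd' : (1 : ℝ) ≤ d := by exact_mod_cast hd
  have hKpos : (0 : ℝ) < K := by
    have h2 : 0 < η ^ 2 * K := lt_of_lt_of_le (by positivity) hK
    exact pos_of_mul_pos_right h2 (by positivity)
  have hexp : ∀ τ : ℝ, η / 40 ≤ τ → Real.exp (-2 * τ ^ 2 * m) ≤ Real.exp (-(η ^ 2 * m / 800)) := by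
    intro τ hτ
    have h2 : (η / 40) ^ 2 ≤ τ ^ 2 := by gcongr
    have h3 := mul_le_mul_of_nonneg_right h2 (Nat.cast_nonneg (α := ℝ) m)
    exact Real.exp_le_exp.2 (by linarith)
  have hdot : ∀ y : Fin n → ℝ, Measurable fun a : Fin n → ℝ => |∑ j, a j * y j| := fun y =>
    (measurable_norm (α := ℝ)).comp (by fun_prop)
  let UW : Set (Fin m × Fin n → ℝ) := {ω | η / 20 * m ≤
    ((Finset.univ.filter fun i => η * K < ∑ k, |∑ j, ω (i, j) * b k j|).card : ℝ)}
  let Ulow (f : Fin d → ℤ) : Set (Fin m × Fin n → ℝ) := {ω | (1 / 2 - η / 20) * m ≤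
    ((Finset.univ.filter fun i => |∑ j, ω (i, j) * gridVec b K f j| ≤ 1 - 2 * η).card : ℝ)}
  let Uupp (f : Fin d → ℤ) : Set (Fin m × Fin n → ℝ) := {ω | (1 / 2 - η / 20) * m ≤
    ((Finset.univ.filter fun i => 1 + 3 * η < |∑ j, ω (i, j) * gridVec b K f j|).card : ℝ)}
  let F := (coeffGrid d K).filter fun f => ∑ j, |gridVec b K f j| ∈ Set.Icc (1 - η) (1 + η)
  have hUW : P.real UW ≤ Real.exp (-(η ^ 2 * m / 800)) := by
    have hE : MeasurableSet {a : Fin n → ℝ | η * K < ∑ k, |∑ j, a j * b k j|} :=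
      measurableSet_lt measurable_const (Finset.measurable_sum _ fun k _ => hdot (b k))
    have hp := (measureReal_lt_sum_abs_sum_mul_le hd hb (mul_pos h0 hKpos)).trans
      (b := (d : ℝ) ^ 2 / (η * K)) (c := η / 40) (by
        rw [div_le_iff₀ (by positivity)]
        nlinarith)
    have h := measureReal_card_rows_ge_le cauchyMeasure m hE hp (τ := η / 40) (by positivity)
    rw [show η / 40 + η / 40 = η / 20 by ring] at h
    exact h.trans (hexp _ le_rfl)
  have hUlow : ∀ f ∈ F, P.real (Ulow f) ≤ Real.exp (-(η ^ 2 * m / 800)) := by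
    intro f hf
    have h := measureReal_card_rows_ge_le cauchyMeasure m
      (measurableSet_le (hdot (gridVec b K f)) measurable_const)
      (measureReal_abs_sum_mul_le h0.le h1 (Finset.mem_filter.1 hf).2.1)
      (τ := η / 20) (by positivity)
    rw [show 1 / 2 - η / 10 + η / 20 = 1 / 2 - η / 20 by ring] at h
    exact h.trans (hexp _ (by linarith))
  have hUupp : ∀ f ∈ F, P.real (Uupp f) ≤ Real.exp (-(η ^ 2 * m / 800)) := by
    intro f hf
    have h := measureReal_card_rows_ge_le cauchyMeasure m
      (measurableSet_lt measurable_const (hdot (gridVec b K f)))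
      (measureReal_lt_abs_sum_mul_le h0.le h1 (Finset.mem_filter.1 hf).2.2)
      (τ := η / 20) (by positivity)
    rw [show 1 / 2 - η / 10 + η / 20 = 1 / 2 - η / 20 by ring] at h
    exact h.trans (hexp _ (by linarith))
  set G : Set (Fin m × Fin n → ℝ) :=
    {ω | ∀ x ∈ L, medNorm (fun i : Fin m => ∑ j, ω (i, j) * x j) ∈
      Set.Icc ((1 - 4 * η) * ∑ j, |x j|) ((1 + 4 * η) * ∑ j, |x j|)} with hG
  have hcover : (Set.univ : Set (Fin m × Fin n → ℝ)) ⊆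
      (UW ∪ ⋃ f ∈ F, (Ulow f ∪ Uupp f)) ∪ G := by
    intro ω _
    refine or_iff_not_imp_left.2 fun hω x hx => ?_
    simp only [Set.mem_union, Set.mem_iUnion, not_or, not_exists] at hω
    obtain ⟨c, hc, hxc⟩ := hbL x hx
    refine medNorm_mem_Icc_of_unit (A := fun i j => ω (i, j)) hm (fun c hc hx1 => ?_) hc hxc
    refine medNorm_mem_Icc_of_sum_abs_eq_one hm (by exact_mod_cast hKpos) ?_ hb
      (not_le.1 hω.1) (fun f hf hfN => not_le.1 (hω.2 f (Finset.mem_filter.2 ⟨hf, hfN⟩)).1)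
      (fun f hf hfN => not_le.1 (hω.2 f (Finset.mem_filter.2 ⟨hf, hfN⟩)).2) hc hx1
    nlinarith [mul_pos h0 hKpos]
  have hF : (F.card : ℝ) ≤ (2 * K + 1) ^ d := by
    have : F.card ≤ (2 * K + 1) ^ d := card_coeffGrid d K ▸ Finset.card_filter_le _ _
    exact_mod_cast this
  have hunion : P.real (⋃ f ∈ F, (Ulow f ∪ Uupp f)) ≤
      2 * (2 * K + 1) ^ d * Real.exp (-(η ^ 2 * m / 800)) :=
    calc P.real (⋃ f ∈ F, (Ulow f ∪ Uupp f)) ≤ ∑ f ∈ F, P.real (Ulow f ∪ Uupp f) :=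
          measureReal_biUnion_finset_le _ _
      _ ≤ ∑ _f ∈ F, 2 * Real.exp (-(η ^ 2 * m / 800)) :=
          Finset.sum_le_sum fun f hf => (measureReal_union_le _ _).trans
            (by linarith [hUlow f hf, hUupp f hf])
      _ = 2 * F.card * Real.exp (-(η ^ 2 * m / 800)) := by
          rw [Finset.sum_const, nsmul_eq_mul]
          ring
      _ ≤ 2 * (2 * K + 1) ^ d * Real.exp (-(η ^ 2 * m / 800)) := by gcongr
  have htotal : (1 : ℝ) ≤ P.real UW + P.real (⋃ f ∈ F, (Ulow f ∪ Uupp f)) + P.real G :=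
    calc (1 : ℝ) = P.real Set.univ := probReal_univ.symm
      _ ≤ P.real ((UW ∪ ⋃ f ∈ F, (Ulow f ∪ Uupp f)) ∪ G) := measureReal_mono hcover
      _ ≤ _ := (measureReal_union_le _ _).trans
        (add_le_add_left (measureReal_union_le _ _) _)
  linarith

theorem net_card_mul_exp_le {d : ℕ} (hd : 2 ≤ d) {ε δ : ℝ} (hε : 0 < ε) (hε1 : ε < 1)
    (hδ : 0 < δ) (hδ1 : δ < 1) {m : ℝ}
    (hm : 192000 * ((d : ℝ) / ε ^ 2) * Real.log ((d : ℝ) / (ε * δ)) ≤ m) :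
    (1 + 2 * (2 * (⌈640 * (d : ℝ) ^ 2 / ε ^ 2⌉₊ : ℝ) + 1) ^ d) *
      Real.exp (-((ε / 4) ^ 2 * m / 800)) ≤ δ := by
  have hd' : (2 : ℝ) ≤ d := by exact_mod_cast hd
  set Q := (d : ℝ) / (ε * δ) with hQ
  have hδQ : 1 / δ ≤ Q := by
    rw [hQ, div_le_div_iff₀ hδ (by positivity)]
    nlinarith
  have hεQ : (d : ℝ) / ε ≤ Q := by
    rw [hQ, div_le_div_iff₀ hε (by positivity)]
    have : ε * δ ≤ ε := mul_le_of_le_one_right hε.le hδ1.le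
    nlinarith
  have hdε : (d : ℝ) ≤ d / ε := by
    rw [le_div_iff₀ hε]
    nlinarith
  have hQ2 : 2 ≤ Q := by linarith
  have hQpos : 0 < Q := by linarith
  have hexp : Real.exp (-((ε / 4) ^ 2 * m / 800)) ≤ ((Q ^ 15) ^ d)⁻¹ := by
    rw [← pow_mul, ← Real.exp_log (pow_pos hQpos (15 * d)), ← Real.exp_neg, Real.log_pow]
    refine Real.exp_le_exp.2 (neg_le_neg ?_)
    have h := mul_le_mul_of_nonneg_left hm (by positivity : 0 ≤ (ε / 4) ^ 2 / 800)
    have h2 : (ε / 4) ^ 2 / 800 * (192000 * ((d : ℝ) / ε ^ 2) * Real.log Q) =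
        15 * d * Real.log Q := by
      field_simp
      ring
    push_cast
    linarith
  set K := ⌈640 * (d : ℝ) ^ 2 / ε ^ 2⌉₊ with hK
  have hK1 : (K : ℝ) ≤ 640 * (d : ℝ) ^ 2 / ε ^ 2 + 1 := (Nat.ceil_lt_add_one (by positivity)).le
  have hbase : 3 * (2 * (K : ℝ) + 1) ≤ Q ^ 14 := by
    have h2 : 640 * (d : ℝ) ^ 2 / ε ^ 2 = 640 * ((d : ℝ) / ε) ^ 2 := by ring
    have h3 : ((d : ℝ) / ε) ^ 2 ≤ Q ^ 2 := by gcongr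
    have h4 : (2 : ℝ) ^ 12 ≤ Q ^ 12 := by gcongr
    have h5 : (2 : ℝ) ^ 2 ≤ Q ^ 2 := by gcongr
    calc 3 * (2 * (K : ℝ) + 1) ≤ 2 ^ 12 * Q ^ 2 := by linarith
      _ ≤ Q ^ 12 * Q ^ 2 := by gcongr
      _ = Q ^ 14 := by ring
  have hone : (1 : ℝ) ≤ (2 * (K : ℝ) + 1) ^ d :=
    one_le_pow₀ (by linarith [Nat.cast_nonneg (α := ℝ) K])
  have hthree : (3 : ℝ) ≤ 3 ^ d := le_self_pow₀ (by norm_num) (by omega)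
  have hcount : 1 + 2 * (2 * (K : ℝ) + 1) ^ d ≤ (Q ^ 14) ^ d :=
    calc 1 + 2 * (2 * (K : ℝ) + 1) ^ d ≤ 3 * (2 * (K : ℝ) + 1) ^ d := by linarith
      _ ≤ 3 ^ d * (2 * (K : ℝ) + 1) ^ d := by gcongr
      _ = (3 * (2 * (K : ℝ) + 1)) ^ d := (mul_pow _ _ _).symm
      _ ≤ (Q ^ 14) ^ d := by gcongr
  calc (1 + 2 * (2 * (K : ℝ) + 1) ^ d) * Real.exp (-((ε / 4) ^ 2 * m / 800))
      ≤ (Q ^ 14) ^ d * ((Q ^ 15) ^ d)⁻¹ := by gcongr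
    _ = (Q ^ d)⁻¹ := by
        rw [pow_succ Q 14, mul_pow, mul_inv, mul_inv_cancel_left₀ (by positivity)]
    _ ≤ Q⁻¹ := inv_anti₀ hQpos (le_self_pow₀ (by linarith) (by omega))
    _ ≤ δ := by
        rw [inv_le_comm₀ hQpos hδ, ← one_div]
        exact hδQ

end Embedding

section Minimizer

theorem le_mul_sInf_image {α : Type*} {S : Set α} {N : α → ℝ} {ρ r : ℝ} (hS : S.Nonempty)
    (hρ : 0 < ρ) (h : ∀ x ∈ S, r ≤ ρ * N x) : r ≤ ρ * sInf (N '' S) := by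
  rw [← div_le_iff₀' hρ]
  refine le_csInf (hS.image N) ?_
  rintro _ ⟨x, hx, rfl⟩
  exact (div_le_iff₀' hρ).2 (h x hx)

theorem measure_pi_cauchyMeasure_sum_mul_eq_zero {ι : Type*} [Fintype ι] {y : ι → ℝ} (hy : y ≠ 0) :
    (Measure.pi fun _ : ι => cauchyMeasure) {a | ∑ j, a j * y j = 0} = 0 := by
  have hN : ∑ j, |y j| ≠ 0 := fun h => hy <| funext fun j => by
    simpa using (Finset.sum_eq_zero_iff_of_nonneg fun j _ => abs_nonneg (y j)).1 h j
  have h := measureReal_pi_cauchyMeasure_abs_sum y (MeasurableSet.singleton (0 : ℝ))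
  have h2 : {t : ℝ | (∑ j, |y j|) * |t| ∈ ({0} : Set ℝ)} = {0} := by
    ext t
    simp [hN]
  rw [h2, measureReal_cauchyMeasure (MeasurableSet.singleton 0)] at h
  simpa [measureReal_def, ENNReal.toReal_eq_zero_iff] using h

/-- On a line, minimizers of the median of a Cauchy sketch almost surely minimize the norm. -/
theorem ae_abs_le_of_medNorm_le {m n : ℕ} (hm : 0 < m) {v : Fin n → ℝ} (hv : v ≠ 0) :
    ∀ᵐ ω ∂(Measure.pi fun _ : Fin m × Fin n => cauchyMeasure), ∀ s t : ℝ,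
      medNorm (fun i : Fin m => ∑ j, ω (i, j) * (s • v) j) ≤
        medNorm (fun i : Fin m => ∑ j, ω (i, j) * (t • v) j) → |s| ≤ |t| := by
  have hae : ∀ᵐ a ∂(Measure.pi fun _ : Fin n => cauchyMeasure), ∑ j, a j * v j ≠ 0 :=
    ae_iff.2 (by simpa using measure_pi_cauchyMeasure_sum_mul_eq_zero hv)
  have hrow : ∀ i : Fin m, ∀ᵐ ω ∂(Measure.pi fun _ : Fin m × Fin n => cauchyMeasure),
      ∑ j, ω (i, j) * v j ≠ 0 := by
    intro i
    have h : ∀ᵐ a ∂(Measure.pi fun _ : Fin m => Measure.pi fun _ : Fin n => cauchyMeasure),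
        ∑ j, a i j * v j ≠ 0 :=
      (measurePreserving_eval (fun _ : Fin m => Measure.pi fun _ : Fin n => cauchyMeasure)
        i).quasiMeasurePreserving.ae
        hae
    rw [← map_curry_pi] at h
    exact ae_of_ae_map (MeasurableEquiv.measurable _).aemeasurable h
  filter_upwards [ae_all_iff.2 hrow] with ω hω s t hst
  have hM := medNorm_pos hm hω
  have hsmul : ∀ r : ℝ, (fun i : Fin m => ∑ j, ω (i, j) * (r • v) j) =
      r • fun i : Fin m => ∑ j, ω (i, j) * v j := fun r => by
    ext i
    simp only [Pi.smul_apply, smul_eq_mul, Finset.mul_sum]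
    exact Finset.sum_congr rfl fun j _ => by ring
  rw [hsmul, hsmul] at hst
  rcases eq_or_ne s 0 with rfl | hs
  · simp
  rw [medNorm_smul hs] at hst
  rcases eq_or_ne t 0 with rfl | ht
  · rw [zero_smul] at hst
    exact absurd (hst.trans (medNorm_zero_le hm)) (not_le.2 (mul_pos (abs_pos.2 hs) hM))
  · rw [medNorm_smul ht] at hst
    exact le_of_mul_le_mul_right hst hM

end Minimizer

/-- Minimizing the median of the Cauchy sketch approximately minimizes the ℓ₁ norm:
with probability at least `1 − δ`, every `x̂ ∈ S ⊆ L` minimizing `‖Ax‖_med` over `S`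
satisfies `‖x̂‖₁ ≤ ((1+ε)/(1−ε)) inf_{x ∈ S} ‖x‖₁`. -/
theorem stmt_12 : ∃ C : ℝ, 0 < C ∧
    ∀ (n d : ℕ), 1 ≤ d → d ≤ n →
    ∀ ε δ : ℝ, 0 < ε → ε < 1 → 0 < δ → δ < 1 →
    ∀ m : ℕ, C * ((d : ℝ) / ε ^ 2) * Real.log ((d : ℝ) / (ε * δ)) ≤ m →
    ∀ L : Submodule ℝ (Fin n → ℝ), Module.finrank ℝ L = d →
    ∀ S : Set (Fin n → ℝ), S ⊆ (L : Set (Fin n → ℝ)) →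
    1 - δ ≤
      ((Measure.pi fun _ : Fin m × Fin n => cauchyMeasure)
        {ω | ∀ xhat ∈ S,
          (∀ x ∈ S, medNorm (fun i : Fin m => ∑ j, ω (i, j) * xhat j) ≤
              medNorm (fun i : Fin m => ∑ j, ω (i, j) * x j)) →
          (∑ i, |xhat i|) ≤ ((1 + ε) / (1 - ε)) *
            sInf ((fun x : Fin n → ℝ => ∑ i, |x i|) '' S)}).toReal := by
  refine ⟨192000, by norm_num, fun n d hd hdn ε δ hε hε1 hδ hδ1 m hm L hL S hS => ?_⟩
  have hd' : (1 : ℝ) ≤ d := by exact_mod_cast hd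
  have hm0 : 0 < m := by
    have hlog : 0 < Real.log ((d : ℝ) / (ε * δ)) := by
      refine Real.log_pos ((one_lt_div (by positivity)).2 ?_)
      nlinarith
    have h : (0 : ℝ) < m := lt_of_lt_of_le (by positivity) hm
    exact_mod_cast h
  have hρ : 1 ≤ (1 + ε) / (1 - ε) := by
    rw [one_le_div (by linarith)]
    linarith
  rw [← measureReal_def]
  rcases hd.eq_or_lt with rfl | hd2
  · obtain ⟨v, hv0, hv⟩ := finrank_eq_one_iff'.1 hL
    have hline : ∀ x ∈ S, ∃ c : ℝ, x = c • (v : Fin n → ℝ) := fun x hx => by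
      obtain ⟨c, hc⟩ := hv ⟨x, hS hx⟩
      exact ⟨c, (congrArg Subtype.val hc).symm⟩
    refine (by linarith : 1 - δ ≤ 1).trans (le_of_eq ?_)
    rw [measureReal_def, measure_congr (Filter.eventuallyEq_univ.2 ?_), measure_univ,
      ENNReal.toReal_one]
    filter_upwards [ae_abs_le_of_medNorm_le (n := n) hm0 (v := (v : Fin n → ℝ))
      (by simpa using hv0)] with ω hω xhat hxhat hmin
    refine le_mul_sInf_image ⟨xhat, hxhat⟩ (by linarith) fun x hx => ?_
    obtain ⟨s, rfl⟩ := hline xhat hxhat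
    obtain ⟨t, rfl⟩ := hline x hx
    have h := hω s t (hmin _ hx)
    have h2 : ∑ j, |(s • (v : Fin n → ℝ)) j| ≤ ∑ j, |(t • (v : Fin n → ℝ)) j| := by
      simp only [Pi.smul_apply, smul_eq_mul, abs_mul]
      exact Finset.sum_le_sum fun j _ => mul_le_mul_of_nonneg_right h (abs_nonneg _)
    exact h2.trans (le_mul_of_one_le_left (Finset.sum_nonneg fun j _ => abs_nonneg _) hρ)
  · have hK : 40 * (d : ℝ) ^ 2 ≤ (ε / 4) ^ 2 * ⌈640 * (d : ℝ) ^ 2 / ε ^ 2⌉₊ := by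
      have h := Nat.le_ceil (640 * (d : ℝ) ^ 2 / ε ^ 2)
      rw [div_le_iff₀ (by positivity)] at h
      linarith
    have h := one_sub_le_measureReal_medNorm_mem_Icc (n := n) (η := ε / 4) hm0 hd (by positivity)
      (by linarith) hK L hL
    rw [mul_div_cancel₀ ε four_ne_zero] at h
    refine (sub_le_sub_left (net_card_mul_exp_le hd2 hε hε1 hδ hδ1 hm) 1).trans
      (h.trans (measureReal_mono fun ω hω xhat hxhat hmin => ?_))
    refine le_mul_sInf_image ⟨xhat, hxhat⟩ (by linarith) fun x hx => ?_
    have h1 := (hω xhat (hS hxhat)).1.trans ((hmin x hx).trans (hω x (hS hx)).2)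
    rw [div_mul_eq_mul_div, le_div_iff₀ (by linarith)]
    linarith
end

section
/- There exist constants c, C > 0 with the following property. Let d ≥ 1 be an integer, ε ∈ (0, 1), and let m be an integer with m ≥ C·d/ε². Let Ĝ be a random m × d matrix with i.i.d. standard Gaussian N(0,1) entries and set G := (√(π/2)/m)·Ĝ. Then with probability at least 1 − e^{−c·d}, simultaneously for all x ∈ ℝ^d: (1 − ε)·‖x‖₂ ≤ ‖G·x‖₁ ≤ (1 + ε)·‖x‖₂. -/
open MeasureTheory ProbabilityTheory

/-- The ball of radius `2` has a `1`-net of cardinality at most `5 ^ dim E`. -/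
lemma exists_finset_net_closedBall (E : Type*) [NormedAddCommGroup E] [NormedSpace ℝ E]
    [FiniteDimensional ℝ E] :
    ∃ N : Finset E, N.card ≤ 5 ^ Module.finrank ℝ E ∧ (∀ y ∈ N, ‖y‖ ≤ 2) ∧
      ∀ x : E, ‖x‖ ≤ 2 → ∃ y ∈ N, ‖x - y‖ ≤ 1 := by
  classical
  let p : ℕ → Prop := fun n ↦ ∃ s : Finset E, s.card = n ∧ (∀ c ∈ s, ‖c‖ ≤ 2) ∧
    ∀ c ∈ s, ∀ d ∈ s, c ≠ d → 1 ≤ ‖c - d‖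
  have hp0 : p 0 := ⟨∅, by simp⟩
  have hbound : ∀ n, p n → n ≤ 5 ^ Module.finrank ℝ E := by
    rintro n ⟨s, rfl, h1, h2⟩
    exact Besicovitch.card_le_of_separated s h1 h2
  obtain ⟨s, hcard, hs, hsep⟩ : p (Nat.findGreatest p (5 ^ Module.finrank ℝ E)) :=
    Nat.findGreatest_spec (Nat.zero_le _) hp0
  refine ⟨s, Besicovitch.card_le_of_separated s hs hsep, hs, fun x hx ↦ ?_⟩
  by_contra! hfar
  have hxs : x ∉ s := fun hmem ↦ by simpa using (hfar x hmem).trans_le' zero_le_one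
  have hins : p (insert x s).card := by
    refine ⟨insert x s, rfl, ?_, ?_⟩
    · simpa [hx] using hs
    · intro c hc d hd hcd
      rcases Finset.mem_insert.1 hc with rfl | hc' <;> rcases Finset.mem_insert.1 hd with rfl | hd'
      · exact absurd rfl hcd
      · exact (hfar d hd').le
      · rw [norm_sub_rev]; exact (hfar c hc').le
      · exact hsep c hc' d hd' hcd
  have := Nat.le_findGreatest (hbound _ hins) hins
  rw [Finset.card_insert_of_notMem hxs] at this
  omega

lemma integral_abs_gaussianReal_zero_one : ∫ x, |x| ∂(gaussianReal 0 1) = √(2 / Real.pi) := by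
  rw [integral_gaussianReal_eq_integral_smul one_ne_zero]
  have h1 : ∀ x : ℝ, gaussianPDFReal 0 1 x • |x| =
      (√(2 * Real.pi))⁻¹ * (|x| ^ (1 : ℝ) * Real.exp (-(1 / 2) * |x| ^ (2 : ℝ))) := by
    intro x
    simp [gaussianPDFReal]
    ring_nf
  simp_rw [h1, integral_const_mul]
  rw [integral_comp_abs (f := fun x ↦ x ^ (1 : ℝ) * Real.exp (-(1 / 2) * x ^ (2 : ℝ))),
    integral_rpow_mul_exp_neg_mul_rpow (by norm_num) (by norm_num) (by norm_num)]
  norm_num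
  field_simp
  norm_num

lemma integral_abs_gaussianReal_zero_left (v : NNReal) :
    ∫ x, |x| ∂(gaussianReal 0 v) = √(2 / Real.pi) * √v := by
  have h := gaussianReal_map_const_mul (μ := 0) (v := 1) (√(v : ℝ))
  have hv : (⟨(√(v : ℝ)) ^ 2, sq_nonneg _⟩ : NNReal) * 1 = v := by
    ext; simp
  have h' : (gaussianReal 0 1).map (fun x ↦ √(v : ℝ) * x) = gaussianReal 0 v := by
    rw [h, mul_zero]; congr 1
  rw [← h', integral_map (by fun_prop) (by fun_prop)]
  simp_rw [abs_mul, abs_of_nonneg (Real.sqrt_nonneg _), integral_const_mul,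
    integral_abs_gaussianReal_zero_one]
  ring

lemma cosh_add_le_cosh_two_mul (p q : ℝ) :
    Real.cosh (p + q) ≤ (Real.cosh (2 * p) + Real.cosh (2 * q)) / 2 := by
  have h1 : Real.cosh (2 * p) + Real.cosh (2 * q) =
      2 * (Real.cosh (p + q) * Real.cosh (p - q)) := by
    have h2 := Real.cosh_add (p + q) (p - q)
    have h3 := Real.cosh_sub (p + q) (p - q)
    rw [show (p + q) + (p - q) = 2 * p by ring] at h2
    rw [show (p + q) - (p - q) = 2 * q by ring] at h3
    linarith
  rw [h1]
  nlinarith [Real.one_le_cosh (p - q), Real.cosh_pos (p + q)]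

open Real in
/-- A centred random variable whose increments are dominated by those of a sub-Gaussian variable is
sub-Gaussian (symmetrisation). -/
lemma hasSubgaussianMGF_of_abs_sub_le {Ω : Type*} [MeasurableSpace Ω] {μ : Measure Ω}
    [IsProbabilityMeasure μ] {f a : Ω → ℝ} {c : NNReal} (hf : Integrable f μ)
    (hf0 : ∫ ω, f ω ∂μ = 0) (h : ∀ x y, |f x - f y| ≤ |a x| + |a y|)
    (ha : HasSubgaussianMGF a c μ) : HasSubgaussianMGF f (4 * c) μ := by
  have hcosh : ∀ t, Integrable (fun ω ↦ cosh (t * a ω)) μ := fun t ↦ by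
    simp_rw [cosh_eq, ← neg_mul]
    exact ((ha.integrable_exp_mul t).add (ha.integrable_exp_mul (-t))).div_const 2
  have hint : ∀ t, Integrable (fun ω ↦ exp (t * f ω)) μ := by
    intro t
    obtain ⟨y⟩ : Nonempty Ω := μ.nonempty_of_neZero
    refine ((hcosh t).const_mul (2 * exp (|t| * (|a y| + |f y|)))).mono'
      (by have := hf.1; fun_prop) (ae_of_all _ fun x ↦ ?_)
    rw [norm_of_nonneg (exp_pos _).le]
    have h1 : t * f x ≤ |t| * (|a y| + |f y|) + |t * a x| := by
      have h2 : |f x| ≤ |a x| + |a y| + |f y| := by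
        have := abs_add_le (f x - f y) (f y)
        rw [sub_add_cancel] at this
        linarith [h x y]
      calc t * f x ≤ |t| * |f x| := by rw [← abs_mul]; exact le_abs_self _
        _ ≤ |t| * (|a x| + |a y| + |f y|) := by gcongr
        _ = _ := by rw [abs_mul]; ring
    have h3 : exp |t * a x| ≤ 2 * cosh (t * a x) := by
      rw [← cosh_abs, cosh_eq]
      linarith [exp_pos (-|t * a x|)]
    calc exp (t * f x) ≤ exp (|t| * (|a y| + |f y|)) * exp |t * a x| := by
          rw [← exp_add]; exact exp_le_exp.2 h1
      _ ≤ exp (|t| * (|a y| + |f y|)) * (2 * cosh (t * a x)) := by gcongr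
      _ = _ := by ring
  refine ⟨hint, fun t ↦ ?_⟩
  have hone : 1 ≤ ∫ ω, exp (-t * f ω) ∂μ := by
    calc (1 : ℝ) = ∫ ω, (1 + -t * f ω) ∂μ := by
          rw [integral_add (by fun_prop) (hf.const_mul _), integral_const_mul, hf0]; simp
      _ ≤ _ := by
          refine integral_mono ((integrable_const _).add (hf.const_mul _)) (hint _) fun ω ↦ ?_
          simpa [add_comm] using add_one_le_exp (-t * f ω)
  have hpos : 0 ≤ mgf f μ t := mgf_nonneg
  have hprod : ∀ s, ∫ z : Ω × Ω, exp (s * (f z.1 - f z.2)) ∂(μ.prod μ) =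
      (∫ ω, exp (s * f ω) ∂μ) * ∫ ω, exp (-s * f ω) ∂μ := fun s ↦ by
    rw [← integral_prod_mul]
    congr 1 with z
    rw [← exp_add]; ring_nf
  have hprodint : ∀ s, Integrable (fun z : Ω × Ω ↦ exp (s * (f z.1 - f z.2))) (μ.prod μ) :=
    fun s ↦ by
    refine ((hint s).mul_prod (hint (-s))).congr (ae_of_all _ fun z ↦ ?_)
    simp only
    rw [← exp_add]; ring_nf
  have hfst : Integrable (fun z : Ω × Ω ↦ cosh (2 * t * a z.1)) (μ.prod μ) :=
    (hcosh (2 * t)).comp_fst μ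
  have hsnd : Integrable (fun z : Ω × Ω ↦ cosh (2 * t * a z.2)) (μ.prod μ) :=
    (hcosh (2 * t)).comp_snd μ
  have hcoshle : ∫ ω, cosh (2 * t * a ω) ∂μ ≤ exp (4 * c * t ^ 2 / 2) := by
    simp_rw [cosh_eq, ← neg_mul]
    rw [integral_div, integral_add (ha.integrable_exp_mul _)
      (by simpa using ha.integrable_exp_mul (-(2 * t)))]
    have h1 := ha.mgf_le (2 * t)
    have h2 := ha.mgf_le (-(2 * t))
    simp only [mgf] at h1 h2
    ring_nf at h1 h2 ⊢
    linarith
  calc mgf f μ t ≤ mgf f μ t * ∫ ω, exp (-t * f ω) ∂μ := le_mul_of_one_le_right hpos hone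
    _ = ∫ z : Ω × Ω, cosh (t * (f z.1 - f z.2)) ∂(μ.prod μ) := by
        simp_rw [cosh_eq, ← neg_mul]
        rw [integral_div, integral_add (hprodint _) (hprodint _), hprod, hprod, mgf, neg_neg]
        ring
    _ ≤ ∫ z : Ω × Ω, (cosh (2 * t * a z.1) + cosh (2 * t * a z.2)) / 2 ∂(μ.prod μ) := by
        refine integral_mono ?_ ((hfst.add hsnd).div_const 2) fun z ↦ ?_
        · simp_rw [cosh_eq, ← neg_mul]
          exact ((hprodint t).add (hprodint (-t))).div_const 2
        · have h1 : cosh (t * (f z.1 - f z.2)) ≤ cosh (|t * a z.1| + |t * a z.2|) := by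
            rw [cosh_le_cosh, abs_of_nonneg (a := |_| + |_|) (by positivity)]
            simp_rw [abs_mul, ← mul_add]
            exact mul_le_mul_of_nonneg_left (h _ _) (abs_nonneg _)
          refine (h1.trans (cosh_add_le_cosh_two_mul _ _)).trans_eq ?_
          have h2 : ∀ x, cosh (2 * |x|) = cosh (2 * x) := fun x ↦ by
            rw [← cosh_abs (2 * x), abs_mul, abs_two]
          simp_rw [h2, mul_assoc]
    _ = ∫ ω, cosh (2 * t * a ω) ∂μ := by
        rw [integral_div, integral_add hfst hsnd, integral_fun_fst (fun x ↦ cosh (2 * t * a x)),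
          integral_fun_snd (fun x ↦ cosh (2 * t * a x))]
        simp
    _ ≤ _ := by exact_mod_cast hcoshle

section StdGaussian

variable {E : Type*} [NormedAddCommGroup E] [InnerProductSpace ℝ E] [FiniteDimensional ℝ E]
  [MeasurableSpace E] [BorelSpace E]

lemma stdGaussian_map_inner (w : E) :
    (stdGaussian E).map (fun g ↦ inner ℝ g w) = gaussianReal 0 (‖w‖₊ ^ 2) := by
  have h := IsGaussian.map_eq_gaussianReal (μ := stdGaussian E) (innerSL ℝ w)
  rw [variance_dual_stdGaussian, integral_strongDual_stdGaussian, innerSL_apply_norm] at h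
  have hfun : (fun g : E ↦ inner ℝ g w) = innerSL ℝ w := by
    ext g
    simp [real_inner_comm]
  rw [hfun, h]
  congr 1
  ext
  simp

lemma integrable_abs_inner_stdGaussian (w : E) :
    Integrable (fun g ↦ |inner ℝ g w|) (stdGaussian E) := by
  have h : Integrable (fun x : ℝ ↦ x) ((stdGaussian E).map (fun g ↦ inner ℝ g w)) := by
    rw [stdGaussian_map_inner]
    exact IsGaussian.integrable_id
  exact (h.comp_measurable (by fun_prop)).abs

lemma integral_abs_inner_stdGaussian (w : E) :
    ∫ g, √(Real.pi / 2) * |inner ℝ g w| ∂(stdGaussian E) = ‖w‖ := by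
  have h := integral_map (μ := stdGaussian E) (φ := fun g ↦ inner ℝ g w) (by fun_prop)
    (f := fun x : ℝ ↦ |x|) (by fun_prop)
  rw [integral_const_mul, ← h, stdGaussian_map_inner, integral_abs_gaussianReal_zero_left,
    ← mul_assoc, ← Real.sqrt_mul (by positivity)]
  have : Real.pi / 2 * (2 / Real.pi) = 1 := by field_simp
  simp [this]

lemma hasSubgaussianMGF_inner_stdGaussian {w : E} {r : NNReal} (hw : ‖w‖ ≤ r) :
    HasSubgaussianMGF (fun g ↦ inner ℝ g w) (r ^ 2) (stdGaussian E) where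
  integrable_exp_mul t := by
    have h := integrable_exp_mul_gaussianReal (μ := 0) (v := ‖w‖₊ ^ 2) t
    rw [← stdGaussian_map_inner] at h
    exact h.comp_measurable (by fun_prop)
  mgf_le t := by
    rw [mgf_gaussianReal (stdGaussian_map_inner w)]
    simp only [zero_mul, zero_add, NNReal.coe_pow, coe_nnnorm]
    gcongr

/-- The increments of the centred process `u ↦ √(π/2) |⟪g, u⟫| - ‖u‖` are sub-Gaussian. -/
lemma hasSubgaussianMGF_abs_inner_sub {u v : E} {r : NNReal} (h : ‖u - v‖ ≤ r) :
    HasSubgaussianMGF (fun g ↦ (√(Real.pi / 2) * |inner ℝ g u| - ‖u‖) -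
      (√(Real.pi / 2) * |inner ℝ g v| - ‖v‖))
      (2 * NNReal.pi * r ^ 2) (stdGaussian E) := by
  have hc : (4 * (⟨√(Real.pi / 2) ^ 2, sq_nonneg _⟩ * r ^ 2) : NNReal) = 2 * NNReal.pi * r ^ 2 := by
    refine NNReal.eq ?_
    change 4 * (√(Real.pi / 2) ^ 2 * (r : ℝ) ^ 2) = 2 * Real.pi * (r : ℝ) ^ 2
    rw [Real.sq_sqrt (by positivity)]
    ring
  rw [← hc]
  have hi : ∀ w : E, Integrable (fun g ↦ √(Real.pi / 2) * |inner ℝ g w| - ‖w‖) (stdGaussian E) :=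
    fun w ↦ ((integrable_abs_inner_stdGaussian w).const_mul _).sub (integrable_const _)
  have hz : ∀ w : E, ∫ g, (√(Real.pi / 2) * |inner ℝ g w| - ‖w‖) ∂(stdGaussian E) = 0 := fun w ↦ by
    rw [integral_sub ((integrable_abs_inner_stdGaussian w).const_mul _) (integrable_const _),
      integral_abs_inner_stdGaussian]
    simp
  refine hasSubgaussianMGF_of_abs_sub_le ((hi u).sub (hi v)) ?_ ?_
    ((hasSubgaussianMGF_inner_stdGaussian h).const_mul √(Real.pi / 2))
  · rw [integral_sub (hi u) (hi v), hz, hz, sub_zero]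
  · intro x y
    have key : ∀ g : E, |(|inner ℝ g u| - |inner ℝ g v|)| ≤ |inner ℝ g (u - v)| := fun g ↦ by
      rw [inner_sub_right]
      exact abs_abs_sub_abs_le _ _
    have hs := Real.sqrt_nonneg (Real.pi / 2)
    simp only [abs_mul, abs_of_nonneg hs]
    calc _ = |√(Real.pi / 2) * (|inner ℝ x u| - |inner ℝ x v|) -
          √(Real.pi / 2) * (|inner ℝ y u| - |inner ℝ y v|)| := by congr 1; ring
      _ ≤ √(Real.pi / 2) * |(|inner ℝ x u| - |inner ℝ x v|)| +
          √(Real.pi / 2) * |(|inner ℝ y u| - |inner ℝ y v|)| := by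
          refine (abs_sub _ _).trans_eq ?_
          simp only [abs_mul, abs_of_nonneg hs]
      _ ≤ _ := add_le_add (mul_le_mul_of_nonneg_left (key x) hs)
          (mul_le_mul_of_nonneg_left (key y) hs)

/-- The centred sum `∑ᵢ (√(π/2) |⟪gᵢ, u⟫| - ‖u‖)`. -/
noncomputable def absDeviation {ι : Type*} [Fintype ι] (g : ι → E) (u : E) : ℝ :=
  ∑ i, (√(Real.pi / 2) * |inner ℝ (g i) u| - ‖u‖)

variable {Ω ι : Type*} [MeasurableSpace Ω] [Fintype ι] {P : Measure Ω} {X : ι → Ω → E}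

omit [FiniteDimensional ℝ E] [MeasurableSpace E] [BorelSpace E] in
lemma continuous_absDeviation (g : ι → E) : Continuous (absDeviation g) := by
  unfold absDeviation
  fun_prop

omit [FiniteDimensional ℝ E] [MeasurableSpace E] [BorelSpace E] in
lemma absDeviation_smul (g : ι → E) {a : ℝ} (ha : 0 ≤ a) (u : E) :
    absDeviation g (a • u) = a * absDeviation g u := by
  simp only [absDeviation, Finset.mul_sum, inner_smul_right, abs_mul, norm_smul, abs_of_nonneg ha,
    Real.norm_eq_abs]
  exact Finset.sum_congr rfl fun i _ ↦ by ring

lemma measureReal_absDeviation_sub_ge_le [IsProbabilityMeasure P] (hX : ∀ i, Measurable (X i))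
    (hind : iIndepFun X P) (hlaw : ∀ i, P.map (X i) = stdGaussian E) {u v : E} {r s : ℝ}
    (h : ‖u - v‖ ≤ r) (hs : 0 ≤ s) :
    P.real {ω | s ≤ |absDeviation (X · ω) u - absDeviation (X · ω) v|} ≤
      2 * Real.exp (-s ^ 2 / (4 * Real.pi * Fintype.card ι * r ^ 2)) := by
  lift r to NNReal using (norm_nonneg _).trans h
  have key : ∀ u v : E, ‖u - v‖ ≤ r →
      P.real {ω | s ≤ absDeviation (X · ω) u - absDeviation (X · ω) v} ≤
        Real.exp (-s ^ 2 / (4 * Real.pi * Fintype.card ι * r ^ 2)) := fun u v h ↦ by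
    have hind' := hind.comp (fun _ g ↦ (√(Real.pi / 2) * |inner ℝ g u| - ‖u‖) -
      (√(Real.pi / 2) * |inner ℝ g v| - ‖v‖)) (fun _ ↦ by fun_prop)
    have hsub : ∀ i ∈ Finset.univ, HasSubgaussianMGF
        ((fun g ↦ (√(Real.pi / 2) * |inner ℝ g u| - ‖u‖) -
          (√(Real.pi / 2) * |inner ℝ g v| - ‖v‖)) ∘ X i) (2 * NNReal.pi * r ^ 2) P := fun i _ ↦
      .of_map (hX i).aemeasurable (by rw [hlaw i]; exact hasSubgaussianMGF_abs_inner_sub h)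
    have hle := HasSubgaussianMGF.measure_sum_ge_le_of_iIndepFun hind' hsub hs
    convert hle using 3
    · ext ω
      simp [absDeviation, ← Finset.sum_sub_distrib]
    · push_cast
      simp only [Finset.sum_const, Finset.card_univ, nsmul_eq_mul, NNReal.coe_real_pi]
      ring
  calc _ ≤ P.real ({ω | s ≤ absDeviation (X · ω) u - absDeviation (X · ω) v} ∪
        {ω | s ≤ absDeviation (X · ω) v - absDeviation (X · ω) u}) :=
        measureReal_mono fun ω hω ↦ by simpa [le_abs] using hω
    _ ≤ _ := (measureReal_union_le _ _).trans <| by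
        rw [two_mul]
        exact add_le_add (key u v h) (key v u (by rwa [norm_sub_rev]))

end StdGaussian

section Chaining

variable {E : Type*} [NormedAddCommGroup E] [NormedSpace ℝ E]

open Classical in
/-- The points `∑ j < k, 2⁻ʲ yⱼ` with all `yⱼ ∈ N`. -/
noncomputable def dyadicPoints (N : Finset E) : ℕ → Finset E
  | 0 => {0}
  | k + 1 => Finset.image₂ (fun a y ↦ a + (1 / 2 : ℝ) ^ k • y) (dyadicPoints N k) N

lemma card_dyadicPoints_le (N : Finset E) (k : ℕ) : (dyadicPoints N k).card ≤ N.card ^ k := by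
  induction k with
  | zero => simp [dyadicPoints]
  | succ k ih =>
    classical
    rw [dyadicPoints, pow_succ]
    exact (Finset.card_image₂_le _ _ _).trans (Nat.mul_le_mul_right _ ih)

lemma abs_le_of_dyadicPoints {N : Finset E}
    (hN : ∀ x : E, ‖x‖ ≤ 2 → ∃ y ∈ N, ‖x - y‖ ≤ 1) {Z : E → ℝ} (hZ : Continuous Z) (hZ0 : Z 0 = 0)
    {t : ℕ → ℝ} {T : ℝ} (hT : ∀ k, ∑ j ∈ Finset.range k, t j ≤ T)
    (hstep : ∀ k, ∀ a ∈ dyadicPoints N k, ∀ y ∈ N, |Z (a + (1 / 2 : ℝ) ^ k • y) - Z a| ≤ t k)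
    {x : E} (hx : ‖x‖ ≤ 2) : |Z x| ≤ T := by
  have main : ∀ k, ∃ a ∈ dyadicPoints N k, ‖x - a‖ ≤ 2 * (1 / 2 : ℝ) ^ k ∧
      |Z a| ≤ ∑ j ∈ Finset.range k, t j := by
    intro k
    induction k with
    | zero => exact ⟨0, by simp [dyadicPoints], by simpa using hx, by simp [hZ0]⟩
    | succ k ih =>
      obtain ⟨a, ha, hxa, hZa⟩ := ih
      have hpos : (0 : ℝ) < (1 / 2) ^ k := by positivity
      obtain ⟨y, hy, hxy⟩ := hN (((1 / 2 : ℝ) ^ k)⁻¹ • (x - a)) (by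
        rw [norm_smul, norm_inv, Real.norm_of_nonneg hpos.le, inv_mul_le_iff₀ hpos]
        linarith)
      refine ⟨a + (1 / 2 : ℝ) ^ k • y, ?_, ?_, ?_⟩
      · classical exact Finset.mem_image₂_of_mem ha hy
      · have : x - (a + (1 / 2 : ℝ) ^ k • y) =
            (1 / 2 : ℝ) ^ k • (((1 / 2 : ℝ) ^ k)⁻¹ • (x - a) - y) := by
          rw [smul_sub, smul_inv_smul₀ hpos.ne']
          abel
        rw [this, norm_smul, Real.norm_of_nonneg hpos.le, pow_succ]
        nlinarith
      · rw [Finset.sum_range_succ]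
        have h1 := hstep k a ha y hy
        have h2 := abs_add_le (Z (a + (1 / 2 : ℝ) ^ k • y) - Z a) (Z a)
        rw [sub_add_cancel] at h2
        linarith
  choose a _ hxa hZa using main
  have hlim : Filter.Tendsto a Filter.atTop (nhds x) := by
    have hpow := (tendsto_pow_atTop_nhds_zero_of_lt_one (r := (1 / 2 : ℝ)) (by norm_num)
      (by norm_num)).const_mul 2
    rw [mul_zero] at hpow
    refine tendsto_iff_norm_sub_tendsto_zero.2
      (squeeze_zero (fun _ ↦ norm_nonneg _) (fun k ↦ ?_) hpow)
    rw [norm_sub_rev]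
    exact hxa k
  exact le_of_tendsto ((hZ.tendsto x).comp hlim).abs
    (Filter.Eventually.of_forall fun k ↦ (hZa k).trans (hT k))

end Chaining

lemma five_pow_mul_exp_le {d : ℕ} (hd : 1 ≤ d) (k : ℕ) :
    (5 : ℝ) ^ (d * (k + 1)) * (2 * Real.exp (-(5 * d * (k + 1)))) ≤
      Real.exp (-d) * (1 / 2) ^ (k + 1) := by
  have he : (2.7 : ℝ) < Real.exp 1 := by linarith [Real.exp_one_gt_d9]
  have h2 : Real.exp 2 = Real.exp 1 ^ 2 := by rw [← Real.exp_nat_mul]; norm_num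
  have h5 : (5 : ℝ) ≤ Real.exp 2 := by rw [h2]; nlinarith
  have h4 : Real.exp (-2) ≤ 1 / 4 := by
    rw [Real.exp_neg, inv_le_comm₀ (Real.exp_pos _) (by norm_num)]
    norm_num
    linarith
  have h5' : (5 : ℝ) ^ (d * (k + 1)) ≤ Real.exp (2 * (d * (k + 1))) := by
    calc (5 : ℝ) ^ (d * (k + 1)) ≤ Real.exp 2 ^ (d * (k + 1)) := by gcongr
      _ = _ := by rw [← Real.exp_nat_mul]; push_cast; ring_nf
  have hd' : (1 : ℝ) ≤ d := by exact_mod_cast hd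
  have hk : (0 : ℝ) ≤ k := k.cast_nonneg
  calc (5 : ℝ) ^ (d * (k + 1)) * (2 * Real.exp (-(5 * d * (k + 1))))
      ≤ Real.exp (2 * (d * (k + 1))) * (2 * Real.exp (-(5 * d * (k + 1)))) := by gcongr
    _ = 2 * Real.exp (-(3 * d * (k + 1))) := by
        rw [mul_left_comm, ← Real.exp_add]; ring_nf
    _ ≤ 2 * Real.exp (-d + (k + 1 : ℕ) * (-2)) := by
        gcongr
        push_cast
        nlinarith [mul_nonneg (sub_nonneg.2 hd') hk]
    _ = Real.exp (-d) * (2 * Real.exp (-2) ^ (k + 1)) := by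
        rw [Real.exp_add, Real.exp_nat_mul]; ring
    _ ≤ Real.exp (-d) * (2 * (1 / 4) ^ (k + 1)) := by gcongr
    _ ≤ _ := by
        gcongr
        have h1 : ((1 : ℝ) / 2) ^ (k + 1) ≤ 1 / 2 :=
          (pow_le_pow_of_le_one (by norm_num) (by norm_num) (Nat.le_add_left 1 k)).trans_eq
            (pow_one _)
        have h2 : (0 : ℝ) < (1 / 2) ^ (k + 1) := by positivity
        rw [show (1 / 4 : ℝ) = 1 / 2 * (1 / 2) by norm_num, mul_pow]
        nlinarith

section Rows

variable {m n : Type*} [Fintype m] [Fintype n]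

lemma map_curry_pi_s15 (ν : Measure ℝ) [IsProbabilityMeasure ν] :
    (Measure.pi fun _ : m × n ↦ ν).map (fun ω i j ↦ ω (i, j)) =
      Measure.pi fun _ : m ↦ Measure.pi fun _ : n ↦ ν := by
  have h : (Measure.pi fun _ : m ↦ Measure.pi fun _ : n ↦ ν).map
      (fun x (p : m × n) ↦ x p.1 p.2) = Measure.pi fun _ : m × n ↦ ν := by
    refine (Measure.pi_eq fun s hs ↦ ?_).symm
    rw [Measure.map_apply (by fun_prop) (MeasurableSet.univ_pi hs)]
    have : (fun (x : m → n → ℝ) (p : m × n) ↦ x p.1 p.2) ⁻¹' Set.univ.pi s =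
        Set.univ.pi fun i ↦ Set.univ.pi fun j ↦ s (i, j) := by
      ext x; simp
    rw [this, Measure.pi_pi, Fintype.prod_prod_type]
    simp_rw [Measure.pi_pi]
  rw [← h, Measure.map_map (by fun_prop) (by fun_prop)]
  exact Measure.map_id

lemma map_row_pi (ν : Measure ℝ) [IsProbabilityMeasure ν] (i : m) :
    (Measure.pi fun _ : m × n ↦ ν).map (fun ω j ↦ ω (i, j)) = Measure.pi fun _ : n ↦ ν := by
  have h := (measurePreserving_eval (fun _ : m ↦ Measure.pi fun _ : n ↦ ν) i).map_eq
  rw [← map_curry_pi_s15, Measure.map_map (by fun_prop) (by fun_prop)] at h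
  exact h

lemma iIndepFun_row_pi (ν : Measure ℝ) [IsProbabilityMeasure ν] :
    iIndepFun (fun (i : m) (ω : m × n → ℝ) (j : n) ↦ ω (i, j)) (Measure.pi fun _ : m × n ↦ ν) := by
  rw [iIndepFun_iff_map_fun_eq_pi_map (fun i ↦ Measurable.aemeasurable (by fun_prop)),
    map_curry_pi_s15]
  simp_rw [map_row_pi]

end Rows

/-- **Dvoretzky's theorem** for independent standard Gaussian rows, with the optimal dependence on
`ε`. -/
lemma exists_measurableSet_abs_absDeviation_le {E : Type*} [NormedAddCommGroup E]
    [InnerProductSpace ℝ E] [FiniteDimensional ℝ E] [MeasurableSpace E] [BorelSpace E]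
    {Ω ι : Type*} [MeasurableSpace Ω] [Fintype ι] {P : Measure Ω} [IsProbabilityMeasure P]
    {X : ι → Ω → E} (hX : ∀ i, Measurable (X i)) (hind : iIndepFun X P)
    (hlaw : ∀ i, P.map (X i) = stdGaussian E) (hd : 1 ≤ Module.finrank ℝ E) {ε : ℝ} (hε : 0 < ε)
    (hm : 1280 * Real.pi * Module.finrank ℝ E / ε ^ 2 ≤ Fintype.card ι) :
    ∃ B : Set Ω, MeasurableSet B ∧ P.real B ≤ Real.exp (-Module.finrank ℝ E) ∧
      ∀ ω ∉ B, ∀ u : E, |absDeviation (X · ω) u| ≤ Fintype.card ι * ε * ‖u‖ := by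
  set d := Module.finrank ℝ E
  set m : ℝ := (Fintype.card ι : ℝ)
  have hd0 : (0 : ℝ) < d := by exact_mod_cast hd
  have hm0 : 0 < m := lt_of_lt_of_le (by positivity) hm
  have hmε : 1280 * Real.pi * d ≤ m * ε ^ 2 := by rwa [div_le_iff₀ (by positivity)] at hm
  obtain ⟨N, hNcard, hN2, hN⟩ := exists_finset_net_closedBall E
  let t : ℕ → ℝ := fun k ↦ m * ε / 4 * (3 / 4) ^ k
  let F : E → Ω → ℝ := fun u ω ↦ absDeviation (X · ω) u
  have hF : ∀ u, Measurable (F u) := fun u ↦ by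
    simp only [F, absDeviation]
    fun_prop
  let A : ℕ → E × E → Set Ω := fun k p ↦
    {ω | t k ≤ |F (p.1 + (1 / 2 : ℝ) ^ k • p.2) ω - F p.1 ω|}
  let S : ℕ → Finset (E × E) := fun k ↦ dyadicPoints N k ×ˢ N
  have hA : ∀ k p, MeasurableSet (A k p) := fun k p ↦
    measurableSet_le measurable_const (((hF _).sub (hF _)).abs)
  have hAle : ∀ k, ∀ p ∈ S k, P.real (A k p) ≤ 2 * Real.exp (-(5 * d * (k + 1))) := by
    rintro k ⟨a, y⟩ hp
    have hy := hN2 y (Finset.mem_product.1 hp).2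
    have hr : ‖a + (1 / 2 : ℝ) ^ k • y - a‖ ≤ 2 * (1 / 2 : ℝ) ^ k := by
      rw [add_sub_cancel_left, norm_smul, Real.norm_of_nonneg (by positivity), mul_comm]
      gcongr
    refine (measureReal_absDeviation_sub_ge_le hX hind hlaw hr (s := t k) (by positivity)).trans ?_
    gcongr
    rw [neg_div, neg_le_neg_iff]
    have hbern : (k : ℝ) + 1 ≤ (9 / 4) ^ k := by
      have := one_add_mul_le_pow (a := (5 / 4 : ℝ)) (by norm_num) k
      norm_num at this
      linarith [(Nat.cast_nonneg k : (0 : ℝ) ≤ k)]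
    have heq : t k ^ 2 / (4 * Real.pi * m * (2 * (1 / 2 : ℝ) ^ k) ^ 2) =
        m * ε ^ 2 / (256 * Real.pi) * (9 / 4) ^ k := by
      have h94 : ((9 : ℝ) / 4) ^ k * ((1 / 2) ^ k) ^ 2 = ((3 / 4) ^ k) ^ 2 := by
        rw [← pow_mul, ← pow_mul, mul_comm k 2, pow_mul, pow_mul, ← mul_pow]
        norm_num
      simp only [t, mul_pow]
      rw [← h94]
      field_simp
      norm_num
    rw [heq]
    have h5 : 5 * (d : ℝ) ≤ m * ε ^ 2 / (256 * Real.pi) := by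
      rw [le_div_iff₀ (by positivity)]
      linarith
    gcongr
  let Bk : ℕ → Set Ω := fun k ↦ ⋃ p ∈ S k, A k p
  have hBk : ∀ k, P.real (Bk k) ≤ Real.exp (-d) * (1 / 2) ^ (k + 1) := by
    intro k
    have hcard : ((S k).card : ℝ) ≤ 5 ^ (d * (k + 1)) := by
      have h1 : (S k).card ≤ (5 ^ d) ^ (k + 1) := by
        rw [Finset.card_product, pow_succ]
        exact Nat.mul_le_mul ((card_dyadicPoints_le N k).trans (Nat.pow_le_pow_left hNcard k))
          hNcard
      rw [pow_mul]
      exact_mod_cast h1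
    calc P.real (Bk k) ≤ ∑ p ∈ S k, P.real (A k p) := measureReal_biUnion_finset_le _ _
      _ ≤ (S k).card * (2 * Real.exp (-(5 * d * (k + 1)))) := by
          rw [← nsmul_eq_mul]
          exact Finset.sum_le_card_nsmul _ _ _ (hAle k)
      _ ≤ 5 ^ (d * (k + 1)) * (2 * Real.exp (-(5 * d * (k + 1)))) := by gcongr
      _ ≤ _ := five_pow_mul_exp_le hd k
  have hsum : HasSum (fun k : ℕ ↦ Real.exp (-d) * (1 / 2) ^ (k + 1)) (Real.exp (-d)) := by
    have := hasSum_geometric_two.mul_left (Real.exp (-d) * (1 / 2))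
    rw [mul_assoc, one_div_mul_cancel two_ne_zero, mul_one] at this
    simpa only [pow_succ', mul_assoc] using this
  refine ⟨⋃ k, Bk k, .iUnion fun k ↦ Finset.measurableSet_biUnion _ fun p _ ↦ hA k p, ?_, ?_⟩
  · refine ENNReal.toReal_le_of_le_ofReal (Real.exp_pos _).le ?_
    calc P (⋃ k, Bk k) ≤ ∑' k, P (Bk k) := measure_iUnion_le _
      _ ≤ ∑' k : ℕ, ENNReal.ofReal (Real.exp (-d) * (1 / 2) ^ (k + 1)) :=
          ENNReal.tsum_le_tsum fun k ↦
            (ENNReal.le_ofReal_iff_toReal_le (measure_ne_top _ _) (by positivity)).2 (hBk k)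
      _ = ENNReal.ofReal (Real.exp (-d)) := by
          rw [← ENNReal.ofReal_tsum_of_nonneg (fun k ↦ by positivity) hsum.summable, hsum.tsum_eq]
  · intro ω hω u
    have hball : ∀ x : E, ‖x‖ ≤ 2 → |absDeviation (X · ω) x| ≤ m * ε := by
      intro x hx
      refine abs_le_of_dyadicPoints hN (continuous_absDeviation _)
        (by simp [absDeviation]) (t := t) (fun k ↦ ?_) (fun k a ha y hy ↦ ?_) hx
      · simp only [t]
        rw [← Finset.mul_sum, geom_sum_eq (by norm_num)]
        have : (0 : ℝ) ≤ (3 / 4) ^ k := by positivity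
        calc m * ε / 4 * (((3 / 4) ^ k - 1) / (3 / 4 - 1)) = m * ε * (1 - (3 / 4) ^ k) := by ring
          _ ≤ m * ε * 1 := by gcongr; linarith
          _ = m * ε := mul_one _
      · by_contra! hlt
        exact hω (Set.mem_iUnion.2 ⟨k, Set.mem_iUnion₂.2
          ⟨(a, y), Finset.mk_mem_product ha hy, hlt.le⟩⟩)
    rcases eq_or_ne u 0 with rfl | hu
    · simp [absDeviation]
    · have hu' : 0 < ‖u‖ := norm_pos_iff.2 hu
      have h1 := hball (‖u‖⁻¹ • u) (by
        rw [norm_smul, norm_inv, norm_norm, inv_mul_cancel₀ hu'.ne']; norm_num)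
      rw [absDeviation_smul _ (by positivity), abs_mul, abs_of_nonneg (by positivity),
        inv_mul_le_iff₀ hu'] at h1
      linarith

/-- Gaussian form of Dvoretzky's theorem for embedding `ℓ₂^d` into `ℓ₁^m`: if
`m ≥ C d/ε²` and `Ĝ` has i.i.d. standard Gaussian entries, then with probability at
least `1 − e^{−cd}` the scaled matrix `G = (√(π/2)/m) Ĝ` satisfies
`(1−ε)‖x‖₂ ≤ ‖Gx‖₁ ≤ (1+ε)‖x‖₂` simultaneously for all `x ∈ ℝ^d`. -/
theorem stmt_15 : ∃ c C : ℝ, 0 < c ∧ 0 < C ∧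
    ∀ (d : ℕ), 1 ≤ d →
    ∀ ε : ℝ, 0 < ε → ε < 1 →
    ∀ m : ℕ, C * (d : ℝ) / ε ^ 2 ≤ m →
    1 - Real.exp (-c * d) ≤
      ((Measure.pi fun _ : Fin m × Fin d => gaussianReal 0 1)
        {ω | ∀ x : Fin d → ℝ,
          (1 - ε) * Real.sqrt (∑ j, (x j) ^ 2) ≤
            (∑ i : Fin m, |Real.sqrt (Real.pi / 2) / m * ∑ j, ω (i, j) * x j|) ∧
          (∑ i : Fin m, |Real.sqrt (Real.pi / 2) / m * ∑ j, ω (i, j) * x j|) ≤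
            (1 + ε) * Real.sqrt (∑ j, (x j) ^ 2)}).toReal := by
  refine ⟨1, 1280 * Real.pi, one_pos, by positivity, fun d hd ε hε _ m hm ↦ ?_⟩
  set P := Measure.pi fun _ : Fin m × Fin d ↦ gaussianReal 0 1
  let X : Fin m → (Fin m × Fin d → ℝ) → EuclideanSpace ℝ (Fin d) :=
    fun i ω ↦ WithLp.toLp 2 fun j ↦ ω (i, j)
  have hX : ∀ i, Measurable (X i) := fun i ↦ by fun_prop
  have hind : iIndepFun X P :=
    (iIndepFun_row_pi (gaussianReal 0 1)).comp (fun _ x ↦ WithLp.toLp 2 x) fun _ ↦ by fun_prop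
  have hlaw : ∀ i, P.map (X i) = stdGaussian (EuclideanSpace ℝ (Fin d)) := fun i ↦ by
    rw [← map_pi_eq_stdGaussian, ← map_row_pi (m := Fin m) (gaussianReal 0 1) i,
      Measure.map_map (by fun_prop) (by fun_prop)]
    rfl
  obtain ⟨B, hB, hPB, hgood⟩ := exists_measurableSet_abs_absDeviation_le hX hind hlaw
    (by simpa using hd) hε (by simpa using hm)
  simp only [finrank_euclideanSpace, Fintype.card_fin] at hPB hgood
  have hm0 : (0 : ℝ) < m := by
    have : (0 : ℝ) < d := by exact_mod_cast hd
    exact lt_of_lt_of_le (by positivity) hm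
  have hsub : Bᶜ ⊆ {ω | ∀ x : Fin d → ℝ,
      (1 - ε) * Real.sqrt (∑ j, (x j) ^ 2) ≤
        (∑ i : Fin m, |Real.sqrt (Real.pi / 2) / m * ∑ j, ω (i, j) * x j|) ∧
      (∑ i : Fin m, |Real.sqrt (Real.pi / 2) / m * ∑ j, ω (i, j) * x j|) ≤
        (1 + ε) * Real.sqrt (∑ j, (x j) ^ 2)} := by
    intro ω hω x
    have h := hgood ω hω (WithLp.toLp 2 x)
    have hnorm : ‖WithLp.toLp 2 x‖ = √(∑ j, x j ^ 2) := by simp [EuclideanSpace.norm_eq]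
    have hdev : absDeviation (X · ω) (WithLp.toLp 2 x) =
        m * (∑ i : Fin m, |√(Real.pi / 2) / m * ∑ j, ω (i, j) * x j| - √(∑ j, x j ^ 2)) := by
      rw [absDeviation, Finset.sum_sub_distrib, mul_sub, Finset.mul_sum, hnorm]
      congr 1
      · refine Finset.sum_congr rfl fun i _ ↦ ?_
        rw [abs_mul, abs_of_nonneg (a := _ / _) (by positivity)]
        simp only [X, PiLp.inner_apply, RCLike.inner_apply, conj_trivial, mul_comm (x _)]
        field_simp
      · simp
    rw [hdev, hnorm, abs_mul, abs_of_pos hm0, mul_assoc, mul_le_mul_iff_right₀ hm0, abs_le] at h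
    constructor <;> linarith [h.1, h.2]
  calc 1 - Real.exp (-1 * d) ≤ 1 - P.real B := by
        rw [neg_one_mul]
        linarith
    _ = P.real Bᶜ := (probReal_compl_eq_one_sub hB).symm
    _ ≤ _ := measureReal_mono hsub
end
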